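/- Let (X,d) be a complete separable metric space in which closed balls are compact, let α be a Young function satisfying the Δ₂-condition, and let μ be a probability measure on X. Then the following are equivalent: (1) there exists C > 0 such that μ satisfies the transport-entropy inequality T_α(C); (2) there exist λ, A > 0 such that μ satisfies the (τ)-log-Sobolev inequality (τ)-LSI_α(λ,A). Moreover, (1) implies (2) for every λ ∈ (0,1/C) with A = 1/(1−λC), and (2) implies (1) with C = (1/λ)·κ_{p_α}·max(A,1)^{p_α−1}, where κ_{p_α} = p_α^{p_α(p_α−1)} / (p_α−1)^{(p_α−1)²}. -/

import Mathlib

open MeasureTheory Filter Set Topology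
open scoped ENNReal NNReal

noncomputable section

/-- The right derivative of a function `α : ℝ → ℝ`. -/
def rightD (α : ℝ → ℝ) (x : ℝ) : ℝ := derivWithin α (Set.Ioi x) x

/-- The left derivative of a function `α : ℝ → ℝ`. -/
def leftD (α : ℝ → ℝ) (x : ℝ) : ℝ := derivWithin α (Set.Iio x) x

/-- A Young function: an even, convex, nonnegative function, increasing on `[0,∞)`,
vanishing at `0` and with vanishing right derivative at `0`. -/
structure IsYoung (α : ℝ → ℝ) : Prop where
  nonneg : ∀ x, 0 ≤ α x
  even : ∀ x, α (-x) = α x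
  convex : ConvexOn ℝ Set.univ α
  mono : StrictMonoOn α (Set.Ici 0)
  zero : α 0 = 0
  rightD_zero : rightD α 0 = 0

/-- The Δ₂-condition for a Young function. -/
def DeltaTwo (α : ℝ → ℝ) : Prop := ∃ K > 0, ∀ x : ℝ, α (2 * x) ≤ K * α x

/-- `r_α = inf_{x>0} x α'₋(x)/α(x)`. -/
def rAlpha (α : ℝ → ℝ) : ℝ := sInf {r : ℝ | ∃ x > 0, r = x * leftD α x / α x}

/-- `p_α = sup_{x>0} x α'₊(x)/α(x)`. -/
def pAlpha (α : ℝ → ℝ) : ℝ := sSup {r : ℝ | ∃ x > 0, r = x * rightD α x / α x}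

/-- The Fenchel-Legendre transform `α*(y) = sup_x {xy - α(x)}`, with values in `[0,∞]`. -/
def legendre (α : ℝ → ℝ) (y : ℝ) : ℝ≥0∞ := ⨆ x : ℝ, ENNReal.ofReal (x * y - α x)

/-- `ξ_α(t) = sup_{u>0} α*(t α'₊(u)) / (t α(u))`. -/
def xiAlpha (α : ℝ → ℝ) (t : ℝ) : ℝ≥0∞ :=
  ⨆ u : {u : ℝ // 0 < u}, legendre α (t * rightD α u) / ENNReal.ofReal (t * α u)

/-- A bounded real-valued function. -/
def IsBoundedFun {Y : Type*} (f : Y → ℝ) : Prop := ∃ M, ∀ x, |f x| ≤ M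

variable {X : Type*} [MetricSpace X] [MeasurableSpace X]

/-- The optimal transport cost `T_α(ν,μ)` between two measures, for the cost
function `(x,y) ↦ α(d(x,y))`. -/
def transportCost (α : ℝ → ℝ) (ν μ : Measure X) : ℝ≥0∞ :=
  sInf { c : ℝ≥0∞ | ∃ π : Measure (X × X), π.map Prod.fst = ν ∧ π.map Prod.snd = μ ∧
      c = ∫⁻ z, ENNReal.ofReal (α (dist z.1 z.2)) ∂π }

open Classical in
/-- The relative entropy `H(ν|μ) = ∫ log (dν/dμ) dν` if `ν ≪ μ` (and `+∞` if `ν` is not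
absolutely continuous with respect to `μ`, or if the integral diverges). -/
def relEnt (ν μ : Measure X) : ℝ≥0∞ :=
  if ν ≪ μ ∧ Integrable (fun x => Real.log (ν.rnDeriv μ x).toReal) ν
  then ENNReal.ofReal (∫ x, Real.log (ν.rnDeriv μ x).toReal ∂ν) else ⊤

/-- The transport-entropy inequality `T_α(C)`: for every probability measure `ν`,
`T_α(ν,μ) ≤ C H(ν|μ)`. -/
def TransportEntropy (μ : Measure X) (α : ℝ → ℝ) (C : ℝ) : Prop :=
  ∀ ν : Measure X, IsProbabilityMeasure ν →
    transportCost α ν μ ≤ ENNReal.ofReal C * relEnt ν μ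

/-- The entropy functional `Ent_μ(e^f)`. -/
def entExp (μ : Measure X) (f : X → ℝ) : ℝ :=
  ∫ x, Real.exp (f x) * Real.log (Real.exp (f x)) ∂μ
    - (∫ x, Real.exp (f x) ∂μ) * Real.log (∫ x, Real.exp (f x) ∂μ)

/-- `|∇⁺ f|(x) = limsup_{y → x} [f(y) - f(x)]₊ / d(y,x)` (equal to `0` at isolated
points by the conventions on `limsup` and `sInf` in `ℝ`). -/
def gradPlus (f : X → ℝ) (x : X) : ℝ :=
  limsup (fun y => max (f y - f x) 0 / dist y x) (𝓝[≠] x)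

/-- `|∇⁻ f|(x) = limsup_{y → x} [f(y) - f(x)]₋ / d(y,x)` (equal to `0` at isolated
points by the conventions on `limsup` and `sInf` in `ℝ`). -/
def gradMinus (f : X → ℝ) (x : X) : ℝ :=
  limsup (fun y => max (-(f y - f x)) 0 / dist y x) (𝓝[≠] x)

/-- The modified log-Sobolev inequality plus `LSI⁺_α(A)`. -/
def LSIplus (μ : Measure X) (α : ℝ → ℝ) (A : ℝ) : Prop :=
  ∀ f : X → ℝ, IsBoundedFun f → LocallyLipschitz f →
    ENNReal.ofReal (entExp μ f) ≤
      ENNReal.ofReal A * ∫⁻ x, legendre α (gradPlus f x) * ENNReal.ofReal (Real.exp (f x)) ∂μ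

/-- The modified log-Sobolev inequality minus `LSI⁻_α(A)`. -/
def LSIminus (μ : Measure X) (α : ℝ → ℝ) (A : ℝ) : Prop :=
  ∀ f : X → ℝ, IsBoundedFun f → LocallyLipschitz f →
    ENNReal.ofReal (entExp μ f) ≤
      ENNReal.ofReal A * ∫⁻ x, legendre α (gradMinus f x) * ENNReal.ofReal (Real.exp (f x)) ∂μ

/-- The inf-convolution operator `Q_α^λ f(x) = inf_y {f(y) + λ α(d(x,y))}`. -/
def QInf (α : ℝ → ℝ) (lam : ℝ) (f : X → ℝ) (x : X) : ℝ :=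
  ⨅ y : X, (f y + lam * α (dist x y))

/-- The `(τ)`-log-Sobolev inequality `(τ)-LSI_α(λ, A)`. -/
def TauLSI (μ : Measure X) (α : ℝ → ℝ) (lam A : ℝ) : Prop :=
  ∀ f : X → ℝ, IsBoundedFun f → LocallyLipschitz f →
    entExp μ f ≤ A * ∫ x, (f x - QInf α lam f x) * Real.exp (f x) ∂μ

/-- The `n`-dimensional inf-convolution operator
`Q_{α,n} f(x) = inf_y {f(y) + Σᵢ α(d(xᵢ,yᵢ))}`. -/
def QInfN (α : ℝ → ℝ) {n : ℕ} (f : (Fin n → X) → ℝ) (x : Fin n → X) : ℝ :=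
  ⨅ y : Fin n → X, (f y + ∑ i, α (dist (x i) (y i)))

/-- The `n`-dimensional sup-convolution operator
`P_{α,n} f(x) = sup_y {f(y) - Σᵢ α(d(xᵢ,yᵢ))}`. -/
def PSupN (α : ℝ → ℝ) {n : ℕ} (f : (Fin n → X) → ℝ) (x : Fin n → X) : ℝ :=
  ⨆ y : Fin n → X, (f y - ∑ i, α (dist (x i) (y i)))

end

namespace IsYoung

variable {α : ℝ → ℝ}

lemma pos (hα : IsYoung α) {x : ℝ} (hx : 0 < x) : 0 < α x := by
  have := hα.mono (Set.mem_Ici.2 le_rfl) (Set.mem_Ici.2 hx.le) hx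
  rwa [hα.zero] at this

lemma le_of_le (hα : IsYoung α) {x y : ℝ} (hx : 0 ≤ x) (hxy : x ≤ y) : α x ≤ α y :=
  hα.mono.monotoneOn hx (hx.trans hxy) hxy

lemma continuous (hα : IsYoung α) : Continuous α := by
  rw [← continuousOn_univ]
  exact hα.convex.continuousOn isOpen_univ

lemma hasDerivWithinAt_rightD (hα : IsYoung α) (x : ℝ) :
    HasDerivWithinAt α (rightD α x) (Ioi x) x :=
  hα.convex.hasDerivWithinAt_rightDeriv_of_mem_interior (by simp)

lemma rightD_le_slope (hα : IsYoung α) {x y : ℝ} (hxy : x < y) :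
    rightD α x ≤ (α y - α x) / (y - x) := by
  have := hα.convex.rightDeriv_le_slope_of_mem_interior (x := x) (y := y) (by simp) (by simp) hxy
  rwa [slope_def_field] at this

lemma mul_rightD_le (hα : IsYoung α) (hΔ : DeltaTwo α) {x : ℝ} (hx : 0 < x) :
    x * rightD α x ≤ pAlpha α * α x := by
  have hbdd : BddAbove {r : ℝ | ∃ x > 0, r = x * rightD α x / α x} := by
    obtain ⟨K, -, hK⟩ := hΔ
    refine ⟨K - 1, ?_⟩
    rintro r ⟨y, hy, rfl⟩
    have h := hα.rightD_le_slope (show y < 2 * y by linarith)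
    rw [le_div_iff₀ (by linarith)] at h
    rw [div_le_iff₀ (hα.pos hy)]
    linarith [hK y]
  have := le_csSup hbdd ⟨x, hx, rfl⟩
  rwa [div_le_iff₀ (hα.pos hx)] at this

lemma mul_rpow_le_mul_rpow (hα : IsYoung α) {p : ℝ}
    (hp : ∀ x > 0, x * rightD α x ≤ p * α x) {x y : ℝ} (hx : 0 < x) (hxy : x ≤ y) :
    α y * x ^ p ≤ α x * y ^ p := by
  have hpos : ∀ z ∈ Icc x y, 0 < z := fun z hz => hx.trans_le hz.1
  have key : α y * y ^ (-p) ≤ α x * x ^ (-p) := by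
    refine image_le_of_deriv_right_le_deriv_boundary (f := fun z => α z * z ^ (-p))
      (f' := fun z => rightD α z * z ^ (-p) + α z * (-p * z ^ (-p - 1)))
      (B := fun _ => α x * x ^ (-p)) (B' := fun _ => 0) (a := x) (b := y) ?_ ?_ le_rfl
      continuousOn_const (fun z _ => hasDerivWithinAt_const ..) ?_ ⟨hxy, le_rfl⟩
    · exact hα.continuous.continuousOn.mul
        (continuousOn_id.rpow_const fun z hz => Or.inl (hpos z hz).ne')
    · intro z hz
      have hz0 := hpos z ⟨hz.1, hz.2.le⟩
      exact ((hα.hasDerivWithinAt_rightD z).mul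
        (Real.hasDerivAt_rpow_const (Or.inl hz0.ne')).hasDerivWithinAt).Ici_of_Ioi
    · intro z hz
      have hz0 := hpos z ⟨hz.1, hz.2.le⟩
      have h1 : z ^ (-p) = z * z ^ (-p - 1) := by
        rw [Real.rpow_sub_one hz0.ne']; field_simp
      have h2 : 0 < z ^ (-p - 1) := Real.rpow_pos_of_pos hz0 _
      rw [h1]
      nlinarith [hp z hz0]
  have hy := hx.trans_le hxy
  rw [Real.rpow_neg hy.le, Real.rpow_neg hx.le, ← div_eq_mul_inv, ← div_eq_mul_inv,
    div_le_div_iff₀ (Real.rpow_pos_of_pos hy _) (Real.rpow_pos_of_pos hx _)] at key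
  exact key

lemma one_lt_pAlpha (hα : IsYoung α) (hΔ : DeltaTwo α) : 1 < pAlpha α := by
  by_contra! hle
  have hp : ∀ x > 0, x * rightD α x ≤ 1 * α x := fun x hx =>
    (hα.mul_rightD_le hΔ hx).trans (mul_le_mul_of_nonneg_right hle (hα.nonneg x))
  have h0 := (hα.hasDerivWithinAt_rightD 0)
  rw [hα.rightD_zero, hasDerivWithinAt_iff_tendsto_slope' (by simp)] at h0
  have : α 1 ≤ 0 := by
    refine ge_of_tendsto h0 ?_
    filter_upwards [Ioo_mem_nhdsGT (show (0 : ℝ) < 1 by norm_num)] with x hx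
    have := hα.mul_rpow_le_mul_rpow hp hx.1 hx.2.le
    simp only [Real.rpow_one, mul_one] at this
    rw [slope_def_field, hα.zero, sub_zero, sub_zero, le_div_iff₀ hx.1]
    exact this
  exact absurd (hα.pos one_pos) this.not_gt

lemma rpow_inv_add_le (hα : IsYoung α) (hΔ : DeltaTwo α) {u v : ℝ} (hu : 0 ≤ u) (hv : 0 ≤ v) :
    α (u + v) ^ (pAlpha α)⁻¹ ≤ α u ^ (pAlpha α)⁻¹ + α v ^ (pAlpha α)⁻¹ := by
  have hp := hα.one_lt_pAlpha hΔ
  have hp0 : 0 < pAlpha α := by linarith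
  rcases hu.eq_or_lt with rfl | hu
  · simp [hα.zero, Real.zero_rpow (inv_ne_zero hp0.ne')]
  rcases hv.eq_or_lt with rfl | hv
  · simp [hα.zero, Real.zero_rpow (inv_ne_zero hp0.ne')]
  have aux : ∀ {x y : ℝ}, 0 < x → x ≤ y →
      α y ^ (pAlpha α)⁻¹ * x ≤ α x ^ (pAlpha α)⁻¹ * y := by
    intro x y hx hxy
    have hy := hx.trans_le hxy
    have h := Real.rpow_le_rpow
      (mul_nonneg (hα.nonneg y) (Real.rpow_nonneg hx.le _))
      (hα.mul_rpow_le_mul_rpow (fun z hz => hα.mul_rightD_le hΔ hz) hx hxy)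
      (inv_nonneg.2 hp0.le)
    rwa [Real.mul_rpow (hα.nonneg y) (Real.rpow_nonneg hx.le _),
      Real.mul_rpow (hα.nonneg x) (Real.rpow_nonneg hy.le _),
      Real.rpow_rpow_inv hx.le hp0.ne', Real.rpow_rpow_inv hy.le hp0.ne'] at h
  have h1 := aux hu (show u ≤ u + v by linarith)
  have h2 := aux hv (show v ≤ u + v by linarith)
  have huv : 0 < u + v := by linarith
  nlinarith

/-- Convexity estimate for the increments of a Young function. -/
lemma rpow_mul_add_le (hα : IsYoung α) (hΔ : DeltaTwo α) {β u v : ℝ} (hβ : 0 < β) (hβ1 : β < 1)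
    (hu : 0 ≤ u) (hv : 0 ≤ v) :
    β ^ (pAlpha α - 1) * α (u + v) ≤
      β ^ (pAlpha α - 1) * (1 - β) ^ (-(pAlpha α - 1)) * α u + α v := by
  set p := pAlpha α with hpdef
  have hp : 1 < p := hα.one_lt_pAlpha hΔ
  have hp0 : 0 < p := by linarith
  have hβ' : 0 < 1 - β := by linarith
  set U := α u ^ p⁻¹
  set V := α v ^ p⁻¹
  have hU : 0 ≤ U := Real.rpow_nonneg (hα.nonneg _) _
  have hV : 0 ≤ V := Real.rpow_nonneg (hα.nonneg _) _
  have hUp : U ^ p = α u := Real.rpow_inv_rpow (hα.nonneg _) hp0.ne'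
  have hVp : V ^ p = α v := Real.rpow_inv_rpow (hα.nonneg _) hp0.ne'
  have h1 : α (u + v) ≤ (U + V) ^ p := by
    rw [← Real.rpow_inv_rpow (hα.nonneg (u + v)) hp0.ne']
    exact Real.rpow_le_rpow (Real.rpow_nonneg (hα.nonneg _) _)
      (hα.rpow_inv_add_le hΔ hu hv) hp0.le
  have h2 : (U + V) ^ p ≤ (1 - β) * (U / (1 - β)) ^ p + β * (V / β) ^ p := by
    have := (convexOn_rpow hp.le).2 (x := U / (1 - β)) (y := V / β)
      (Set.mem_Ici.2 (by positivity)) (Set.mem_Ici.2 (by positivity)) hβ'.le hβ.le (by ring)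
    simp only [smul_eq_mul] at this
    rwa [mul_div_cancel₀ _ hβ'.ne', mul_div_cancel₀ _ hβ.ne'] at this
  rw [Real.div_rpow hU hβ'.le, Real.div_rpow hV hβ.le, hUp, hVp] at h2
  have e1 : (1 - β) ^ p = (1 - β) * (1 - β) ^ (p - 1) := by
    rw [Real.rpow_sub_one hβ'.ne']; field_simp
  have e2 : β ^ p = β * β ^ (p - 1) := by
    rw [Real.rpow_sub_one hβ.ne']; field_simp
  have p1 : 0 < (1 - β) ^ (p - 1) := Real.rpow_pos_of_pos hβ' _
  have p2 : 0 < β ^ (p - 1) := Real.rpow_pos_of_pos hβ _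
  calc β ^ (p - 1) * α (u + v)
      ≤ β ^ (p - 1) * ((1 - β) * (α u / (1 - β) ^ p) + β * (α v / β ^ p)) :=
        mul_le_mul_of_nonneg_left (h1.trans h2) p2.le
    _ = _ := by
        rw [e1, e2, Real.rpow_neg hβ'.le]
        field_simp

lemma mul_le (hα : IsYoung α) {x : ℝ} (hx : 1 ≤ x) : x * α 1 ≤ α x := by
  have h := hα.convex.2 (mem_univ (0 : ℝ)) (mem_univ x)
    (show 0 ≤ 1 - x⁻¹ by rw [sub_nonneg]; exact inv_le_one_of_one_le₀ hx)
    (show 0 ≤ x⁻¹ by positivity) (by ring)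
  have hx0 : 0 < x := by linarith
  simp only [smul_eq_mul, mul_zero, zero_add, hα.zero, inv_mul_cancel₀ hx0.ne'] at h
  rwa [inv_mul_eq_div, le_div_iff₀ hx0, mul_comm] at h

/-- A Young function is Lipschitz on bounded intervals. -/
lemma sub_le_of_le (hα : IsYoung α) {R x y : ℝ} (hxy : x ≤ y) (hyR : y ≤ R) :
    α y - α x ≤ (α (R + 1) - α R) * (y - x) := by
  rcases hxy.eq_or_lt with rfl | hxy
  · simp
  have h1 : (α y - α x) / (y - x) ≤ rightD α y := by
    have := hα.convex.slope_le_leftDeriv_of_mem_interior (x := x) (y := y) (by simp) (by simp) hxy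
    rw [slope_def_field] at this
    exact this.trans (hα.convex.leftDeriv_le_rightDeriv_of_mem_interior (by simp))
  have h2 : rightD α y ≤ rightD α R :=
    hα.convex.monotoneOn_rightDeriv (by simp) (by simp) hyR
  have h3 := hα.rightD_le_slope (show R < R + 1 by linarith)
  rw [add_sub_cancel_left, div_one] at h3
  rw [div_le_iff₀ (by linarith)] at h1
  exact h1.trans (mul_le_mul_of_nonneg_right (h2.trans h3) (by linarith))

end IsYoung

/-- The function `β ↦ (1 - β) ^ (-q) - 1` lies below its chord on `[0, b]`. -/
lemma one_sub_rpow_neg_sub_one_le {q β b : ℝ} (hq : 0 < q) (hβ : 0 ≤ β) (hβb : β ≤ b)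
    (hb : 0 < b) (hb1 : b < 1) :
    (1 - β) ^ (-q) - 1 ≤ ((1 - b) ^ (-q) - 1) / b * β := by
  set θ := β / b with hθ
  have hθ0 : 0 ≤ θ := by positivity
  have hθ1 : 0 ≤ 1 - θ := by rw [sub_nonneg]; exact div_le_one_of_le₀ hβb hb.le
  have hb' : 0 < 1 - b := by linarith
  have h1 : (1 - b) ^ θ ≤ 1 - β := by
    have := Real.geom_mean_le_arith_mean2_weighted hθ1 hθ0 zero_le_one hb'.le (by ring)
    rw [Real.one_rpow, one_mul] at this
    refine this.trans_eq ?_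
    rw [hθ]; field_simp; ring
  have h2 : (1 - β) ^ (-q) ≤ ((1 - b) ^ (-q)) ^ θ := by
    rw [← Real.rpow_mul hb'.le, mul_comm, Real.rpow_mul hb'.le]
    exact Real.rpow_le_rpow_of_nonpos (Real.rpow_pos_of_pos hb' _) h1 (by linarith)
  have h3 := Real.geom_mean_le_arith_mean2_weighted hθ1 hθ0 zero_le_one
    (Real.rpow_nonneg hb'.le (-q)) (by ring)
  rw [Real.one_rpow, one_mul] at h3
  calc _ ≤ _ := sub_le_sub_right (h2.trans h3) 1
    _ = _ := by rw [hθ]; field_simp; ring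

section Convolution

variable {X : Type*} [MetricSpace X] {α : ℝ → ℝ} {lam M : ℝ} {f : X → ℝ}

lemma QInf_le_add (hα : IsYoung α) (hlam : 0 ≤ lam) (hf : ∀ x, |f x| ≤ M) (x y : X) :
    QInf α lam f x ≤ f y + lam * α (dist x y) :=
  ciInf_le ⟨-M, by
    rintro _ ⟨z, rfl⟩
    have := mul_nonneg hlam (hα.nonneg (dist x z))
    have := (abs_le.1 (hf z)).1
    simp only
    linarith⟩ y

lemma QInf_le_self (hα : IsYoung α) (hlam : 0 ≤ lam) (hf : ∀ x, |f x| ≤ M) (x : X) :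
    QInf α lam f x ≤ f x := by
  simpa [hα.zero] using QInf_le_add hα hlam hf x x

lemma abs_QInf_le (hα : IsYoung α) (hlam : 0 ≤ lam) (hf : ∀ x, |f x| ≤ M) (x : X) :
    |QInf α lam f x| ≤ M := by
  have : Nonempty X := ⟨x⟩
  refine abs_le.2 ⟨le_ciInf fun y => ?_,
    (QInf_le_self hα hlam hf x).trans (le_of_abs_le (hf x))⟩
  have := mul_nonneg hlam (hα.nonneg (dist x y))
  linarith [(abs_le.1 (hf y)).1]

lemma locallyLipschitz_QInf (hα : IsYoung α) (hlam : 0 < lam) (hf : ∀ x, |f x| ≤ M) :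
    LocallyLipschitz (QInf α lam f) := by
  set R : ℝ := max 1 (2 * M / (lam * α 1)) with hR
  have hα1 : 0 < lam * α 1 := mul_pos hlam (hα.pos one_pos)
  have hR1 : 1 ≤ R := le_max_left _ _
  have hRM : 2 * M ≤ lam * α R := by
    have h1 : 2 * M ≤ R * (lam * α 1) := by
      rw [← div_le_iff₀ hα1]; exact le_max_right _ _
    have h2 := mul_le_mul_of_nonneg_left (hα.mul_le hR1) hlam.le
    linarith
  set L : ℝ := lam * (α (R + 1 + 1) - α (R + 1)) with hL
  have hL0 : 0 ≤ L :=
    mul_nonneg hlam.le (sub_nonneg.2 (hα.le_of_le (by linarith) (by linarith)))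
  have key : ∀ x x' : X, dist x x' ≤ 1 → QInf α lam f x ≤ QInf α lam f x' + L * dist x x' := by
    intro x x' hxx
    have : Nonempty X := ⟨x⟩
    rw [← sub_le_iff_le_add]
    refine le_ciInf fun y => ?_
    rw [sub_le_iff_le_add]
    have hd0 : 0 ≤ dist x x' := dist_nonneg
    rcases le_or_gt (dist x' y) R with hy | hy
    · have h1 : α (dist x y) ≤ α (dist x' y + dist x x') :=
        hα.le_of_le dist_nonneg (by linarith [dist_triangle x x' y])
      have h2 := hα.sub_le_of_le (R := R + 1) (x := dist x' y) (y := dist x' y + dist x x')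
        (by linarith) (by linarith)
      rw [add_sub_cancel_left] at h2
      have h3 := mul_le_mul_of_nonneg_left (h1.trans (sub_le_iff_le_add.1 h2)) hlam.le
      have h4 := QInf_le_add hα hlam.le hf x y
      rw [hL]
      linarith
    · have h1 := mul_le_mul_of_nonneg_left (hα.le_of_le (by linarith) hy.le) hlam.le
      have h2 := (abs_le.1 (hf y)).1
      have h3 := le_of_abs_le (abs_QInf_le hα hlam.le hf x)
      have h4 := mul_nonneg hL0 hd0
      linarith
  intro x
  refine ⟨⟨L, hL0⟩, Metric.ball x (1 / 2), Metric.ball_mem_nhds x (by norm_num), ?_⟩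
  refine LipschitzOnWith.of_le_add_mul _ fun y hy z hz => key y z ?_
  have := dist_triangle_right y z x
  rw [Metric.mem_ball] at hy hz
  linarith

/-- The sup-convolution `x ↦ sup_y {g(y) - a α(d(x,y))}`. -/
noncomputable def supConv (α : ℝ → ℝ) (a : ℝ) (g : X → ℝ) (x : X) : ℝ :=
  -QInf α a (fun y => -g y) x

variable {a : ℝ} {g : X → ℝ}

lemma sub_le_supConv (hα : IsYoung α) (ha : 0 ≤ a) (hg : ∀ x, |g x| ≤ M) (x y : X) :
    g y - a * α (dist x y) ≤ supConv α a g x := by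
  have := QInf_le_add hα ha (f := fun y => -g y) (M := M) (by simpa using hg) x y
  simp only [supConv]
  linarith

lemma supConv_le {x : X} {c : ℝ} (h : ∀ y, g y - a * α (dist x y) ≤ c) :
    supConv α a g x ≤ c := by
  have : Nonempty X := ⟨x⟩
  rw [supConv, neg_le]
  exact le_ciInf fun y => by linarith [h y]

lemma abs_supConv_le (hα : IsYoung α) (ha : 0 ≤ a) (hg : ∀ x, |g x| ≤ M) (x : X) :
    |supConv α a g x| ≤ M := by
  rw [supConv, abs_neg]
  exact abs_QInf_le hα ha (by simpa using hg) x

lemma le_supConv (hα : IsYoung α) (ha : 0 ≤ a) (hg : ∀ x, |g x| ≤ M) (x : X) :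
    g x ≤ supConv α a g x := by
  simpa [hα.zero] using sub_le_supConv hα ha hg x x

lemma supConv_anti (hα : IsYoung α) {a' : ℝ} (ha' : 0 ≤ a') (haa' : a' ≤ a)
    (hg : ∀ x, |g x| ≤ M) (x : X) : supConv α a g x ≤ supConv α a' g x :=
  supConv_le fun y => by
    have := mul_le_mul_of_nonneg_right haa' (hα.nonneg (dist x y))
    linarith [sub_le_supConv hα ha' hg x y]

lemma locallyLipschitz_mul_supConv (hα : IsYoung α) (ha : 0 < a) (hg : ∀ x, |g x| ≤ M) (s : ℝ) :
    LocallyLipschitz fun x => s * supConv α a g x := by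
  intro x
  obtain ⟨K, t, ht, hK⟩ :=
    locallyLipschitz_QInf hα ha (f := fun y => -g y) (M := M) (by simpa using hg) x
  refine ⟨‖s‖₊ * K, t, ht, LipschitzOnWith.of_dist_le_mul fun y hy z hz => ?_⟩
  have := hK.dist_le_mul y hy z hz
  rw [Real.dist_eq] at this ⊢
  rw [← mul_sub, abs_mul, NNReal.coe_mul, coe_nnnorm, Real.norm_eq_abs, mul_assoc]
  refine mul_le_mul_of_nonneg_left ?_ (abs_nonneg s)
  rwa [supConv, supConv, neg_sub_neg, abs_sub_comm]

/-- Pointwise comparison of two sup-convolutions through the defect `f - Q f`. -/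
lemma supConv_add_le_supConv (hα : IsYoung α) (hΔ : DeltaTwo α) (hg : ∀ x, |g x| ≤ M)
    {b β s a' : ℝ} (hlam : 0 < lam) (hb1 : b < 1) (hβ : 0 < β) (hβb : β ≤ b)
    (hs : 0 < s) (ha' : 0 ≤ a') (haa' : a' ≤ a) (hsa : s * a = lam * β ^ (pAlpha α - 1)) (x : X) :
    supConv α a g x +
        (a - a') / (lam * (((1 - b) ^ (-(pAlpha α - 1)) - 1) / b * β * β ^ (pAlpha α - 1))) *
          (s * supConv α a g x - QInf α lam (fun z => s * supConv α a g z) x) ≤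
      supConv α a' g x := by
  have hp := hα.one_lt_pAlpha hΔ
  set q := pAlpha α - 1 with hq
  have hq0 : 0 < q := by linarith
  have hb : 0 < b := hβ.trans_le hβb
  have hc : 0 < (1 - b) ^ (-q) - 1 := by
    rw [sub_pos]
    exact Real.one_lt_rpow_of_pos_of_lt_one_of_neg (by linarith) (by linarith) (by linarith)
  set c := ((1 - b) ^ (-q) - 1) / b with hcdef
  have hc0 : 0 < c := div_pos hc hb
  have hβq : 0 < β ^ q := Real.rpow_pos_of_pos hβ _
  set n := lam * (c * β * β ^ q) with hn
  have hn0 : 0 < n := by positivity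
  have ha : 0 ≤ a := ha'.trans haa'
  set S := supConv α a g with hS
  set Q := QInf α lam (fun z => s * S z) x with hQ
  have step : ∀ y, s * (g y - a * α (dist x y)) ≤ n * α (dist x y) + Q := by
    intro y
    rw [← sub_le_iff_le_add']
    have : Nonempty X := ⟨x⟩
    refine le_ciInf fun z => ?_
    have h1 := mul_le_mul_of_nonneg_left (sub_le_supConv hα ha hg z y) hs.le
    have h2 : α (dist z y) ≤ α (dist x y + dist x z) :=
      hα.le_of_le dist_nonneg (by linarith [dist_triangle_left z y x])
    have h3 := hα.rpow_mul_add_le hΔ hβ (hβb.trans_lt hb1) (dist_nonneg (x := x) (y := y))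
      (dist_nonneg (x := x) (y := z))
    have h4 := one_sub_rpow_neg_sub_one_le hq0 hβ.le hβb hb hb1
    rw [← hcdef] at h4
    have h5 := mul_le_mul_of_nonneg_left h4 (mul_nonneg hβq.le (hα.nonneg (dist x y)))
    have h6 : s * (a * α (dist z y)) ≤ lam * (β ^ q * α (dist x y + dist x z)) := by
      rw [← mul_assoc, hsa, mul_assoc]
      gcongr
    have h7 : s * (a * α (dist x y)) = lam * (β ^ q * α (dist x y)) := by
      rw [← mul_assoc, hsa, mul_assoc]
    have h8 : lam * (β ^ q * α (dist x y + dist x z)) ≤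
        lam * (β ^ q * α (dist x y) + c * β * β ^ q * α (dist x y) + α (dist x z)) := by
      gcongr
      linarith
    rw [hn]
    linarith
  set κ := (a - a') / n with hκ
  have hκ0 : 0 ≤ κ := div_nonneg (by linarith) hn0.le
  have hκn : a - a' = κ * n := by rw [hκ]; field_simp
  have h1 : S x ≤ (supConv α a' g x + κ * Q) / (1 + κ * s) := by
    refine supConv_le fun y => ?_
    rw [le_div_iff₀ (by positivity)]
    have h2 := sub_le_supConv hα ha' hg x y
    have h3 := mul_le_mul_of_nonneg_left (step y) hκ0
    have h4 : a' = a - κ * n := by linarith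
    rw [h4] at h2
    rw [h4]
    linarith
  rw [le_div_iff₀ (by positivity)] at h1
  linarith

end Convolution

section Herbst

lemma integrable_of_measurable_of_abs_le {Y : Type*} [MeasurableSpace Y] {μ : Measure Y}
    [IsFiniteMeasure μ] {f : Y → ℝ} (hf : Measurable f) {M : ℝ} (hM : ∀ x, |f x| ≤ M) :
    Integrable f μ :=
  Integrable.of_bound hf.aestronglyMeasurable M (ae_of_all _ hM)

lemma integrable_mul_exp {Y : Type*} [MeasurableSpace Y] {μ : Measure Y}
    [IsFiniteMeasure μ] {f h : Y → ℝ} (hf : Measurable f) {M : ℝ} (hM : ∀ x, |f x| ≤ M)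
    (hh : Measurable h) {N : ℝ} (hN : ∀ x, |h x| ≤ N) :
    Integrable (fun x => h x * Real.exp (f x)) μ := by
  refine integrable_of_measurable_of_abs_le (hh.mul hf.exp) (M := N * Real.exp M) fun x => ?_
  rw [abs_mul, Real.abs_exp]
  exact mul_le_mul (hN x) (Real.exp_le_exp.2 (le_of_abs_le (hM x))) (Real.exp_pos _).le
    ((abs_nonneg _).trans (hN x))

lemma integrable_exp {Y : Type*} [MeasurableSpace Y] {μ : Measure Y}
    [IsFiniteMeasure μ] {f : Y → ℝ} (hf : Measurable f) {M : ℝ} (hM : ∀ x, |f x| ≤ M) :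
    Integrable (fun x => Real.exp (f x)) μ := by
  simpa using integrable_mul_exp (μ := μ) hf hM (h := fun _ => 1) measurable_const
    (N := 1) (by simp)

/-- The Gibbs variational inequality for bounded functions. -/
lemma integral_sub_mul_exp_le {Y : Type*} [MeasurableSpace Y] {μ : Measure Y}
    [IsProbabilityMeasure μ] {f φ : Y → ℝ} (hf : Measurable f) {M : ℝ} (hM : ∀ x, |f x| ≤ M)
    (hφ : Measurable φ) {N : ℝ} (hN : ∀ x, |φ x| ≤ N) :
    ∫ x, (φ x - f x) * Real.exp (f x) ∂μ ≤ (∫ x, Real.exp (f x) ∂μ) *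
      (Real.log (∫ x, Real.exp (φ x) ∂μ) - Real.log (∫ x, Real.exp (f x) ∂μ)) := by
  have if1 := integrable_exp (μ := μ) hf hM
  have if2 := integrable_exp (μ := μ) hφ hN
  have iφ := integrable_mul_exp (μ := μ) hf hM (hφ.sub hf) (N := N + M) fun x =>
    (abs_sub _ _).trans (add_le_add (hN x) (hM x))
  set Z := ∫ x, Real.exp (f x) ∂μ with hZ
  set W := ∫ x, Real.exp (φ x) ∂μ with hW
  have hZ0 : 0 < Z := integral_exp_pos if1
  have hW0 : 0 < W := integral_exp_pos if2
  set l := Real.log W - Real.log Z with hl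
  have hexp : Real.exp l = W / Z := by
    rw [hl, Real.exp_sub, Real.exp_log hW0, Real.exp_log hZ0]
  have key : ∫ x, (Real.exp (f x) + (φ x - f x) * Real.exp (f x) - l * Real.exp (f x)) ∂μ ≤
      ∫ x, Real.exp (φ x) * (Z / W) ∂μ := by
    refine integral_mono ((if1.add iφ).sub (if1.const_mul l)) (if2.mul_const _) fun x => ?_
    have h1 := Real.add_one_le_exp (φ x - f x - l)
    have h2 : Real.exp (φ x) * (Z / W) = Real.exp (φ x - f x - l) * Real.exp (f x) := by
      rw [Real.exp_sub, Real.exp_sub, hexp]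
      field_simp
    simp only
    rw [h2]
    nlinarith [Real.exp_pos (f x)]
  have iφ' : Integrable (fun x => (φ x - f x) * Real.exp (f x)) μ := iφ
  have iadd : Integrable (fun x => Real.exp (f x) + (φ x - f x) * Real.exp (f x)) μ := if1.add iφ'
  rw [integral_sub iadd (if1.const_mul l), integral_add if1 iφ', integral_const_mul,
    integral_mul_const, ← hZ, ← hW, mul_div_cancel₀ _ hW0.ne'] at key
  linarith

lemma le_of_forall_le_add_mul_sq {Γ : ℝ → ℝ} {x y K : ℝ} (hxy : x ≤ y)
    (h : ∀ u v, x ≤ u → u ≤ v → v ≤ y → Γ v ≤ Γ u + K * (v - u) ^ 2) : Γ y ≤ Γ x := by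
  have hn : ∀ n : ℕ, Γ y ≤ Γ x + K * (y - x) ^ 2 * (1 / ((n : ℝ) + 1)) := by
    intro n
    set N : ℝ := (n : ℝ) + 1 with hN
    have hN0 : 0 < N := by positivity
    set e := (y - x) / N with he
    have he0 : 0 ≤ e := div_nonneg (by linarith) hN0.le
    have heN : e * N = y - x := by rw [he]; field_simp
    have ind : ∀ j : ℕ, j ≤ n + 1 → Γ (x + j * e) ≤ Γ x + j * (K * e ^ 2) := by
      intro j
      induction j with
      | zero => simp
      | succ j ih =>
        intro hj
        have hj' : ((j : ℝ) + 1) ≤ N := by rw [hN]; exact_mod_cast hj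
        have h1 := ih (by omega)
        have hje : 0 ≤ (j : ℝ) * e := by positivity
        have h2 := h (x + j * e) (x + (j + 1) * e) (by linarith) (by linarith)
          (by nlinarith)
        push_cast
        have h3 : x + ((j : ℝ) + 1) * e - (x + j * e) = e := by ring
        rw [h3] at h2
        linarith
    have h1 := ind (n + 1) le_rfl
    push_cast at h1
    rw [← hN] at h1
    have h2 : x + N * e = y := by linarith
    rw [h2] at h1
    refine h1.trans_eq ?_
    rw [he]
    field_simp
  have hlim : Tendsto (fun n : ℕ => Γ x + K * (y - x) ^ 2 * (1 / ((n : ℝ) + 1))) atTop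
      (𝓝 (Γ x + K * (y - x) ^ 2 * 0)) :=
    tendsto_const_nhds.add (tendsto_const_nhds.mul tendsto_one_div_add_atTop_nhds_zero_nat)
  rw [mul_zero, add_zero] at hlim
  exact ge_of_tendsto' hlim hn

variable {X : Type*} [MeasurableSpace X]

/-- One step of the Herbst argument along a decreasing family of functions. -/
lemma log_integral_exp_step {μ : Measure X} [IsProbabilityMeasure μ] {F F' R : X → ℝ}
    {M N r s κ B δ : ℝ} (hF : Measurable F) (hFM : ∀ x, |F x| ≤ M)
    (hF' : Measurable F') (hFM' : ∀ x, |F' x| ≤ M)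
    (hR : Measurable R) (hRN : ∀ x, |R x| ≤ N)
    (hr : 0 < r) (hs : 0 < s) (hs1 : s ≤ 1) (hκ : 0 ≤ κ) (hB : 0 < B) (hδ : 0 ≤ δ)
    (hcomp : ∀ x, F x + κ * R x ≤ F' x)
    (hent : entExp μ (fun x => s * F x) ≤ B * ∫ x, R x * Real.exp (s * F x) ∂μ)
    (hδle : -δ ≤ r * κ / B - (1 - r / s)) :
    1 / s * Real.log (∫ x, Real.exp (s * F x) ∂μ) ≤
      1 / r * Real.log (∫ x, Real.exp (r * F' x) ∂μ) + 2 * M * δ / r := by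
  have hsF : Measurable fun x => s * F x := hF.const_mul s
  have hsFM : ∀ x, |s * F x| ≤ s * M := fun x => by
    rw [abs_mul, abs_of_pos hs]; exact mul_le_mul_of_nonneg_left (hFM x) hs.le
  have hrF : Measurable fun x => r * F' x := hF'.const_mul r
  have hrFM : ∀ x, |r * F' x| ≤ r * M := fun x => by
    rw [abs_mul, abs_of_pos hr]; exact mul_le_mul_of_nonneg_left (hFM' x) hr.le
  have g1 := integral_sub_mul_exp_le (μ := μ) hsF hsFM hrF hrFM
  have g2 := integral_sub_mul_exp_le (μ := μ) hsF hsFM (φ := fun _ => 0) measurable_const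
    (N := 0) (by simp)
  have g3 := integral_sub_mul_exp_le (μ := μ) (f := fun _ => 0) measurable_const
    (M := 0) (by simp) hsF hsFM
  have iE := integrable_exp (μ := μ) hsF hsFM
  have iF := integrable_mul_exp (μ := μ) hsF hsFM hsF hsFM
  have iR := integrable_mul_exp (μ := μ) hsF hsFM hR hRN
  have iD := integrable_mul_exp (μ := μ) hsF hsFM (hrF.sub hsF) (N := r * M + s * M) fun x =>
    (abs_sub _ _).trans (add_le_add (hrFM x) (hsFM x))
  have hEnt : entExp μ (fun x => s * F x) = ∫ x, s * F x * Real.exp (s * F x) ∂μ -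
      (∫ x, Real.exp (s * F x) ∂μ) * Real.log (∫ x, Real.exp (s * F x) ∂μ) := by
    simp only [entExp, Real.log_exp, mul_comm]
  set Z := ∫ x, Real.exp (s * F x) ∂μ with hZ
  set I := ∫ x, s * F x * Real.exp (s * F x) ∂μ with hI
  set J := ∫ x, R x * Real.exp (s * F x) ∂μ with hJ
  set E := entExp μ (fun x => s * F x) with hE
  set L := Real.log Z with hL
  set L' := Real.log (∫ x, Real.exp (r * F' x) ∂μ) with hL'
  have hZ0 : 0 < Z := integral_exp_pos iE
  have hE0 : 0 ≤ E := by
    simp only [zero_sub, neg_mul, integral_neg, Real.exp_zero, integral_const, probReal_univ,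
      smul_eq_mul, mul_one, Real.log_one] at g2
    linarith
  have hL0 : -(s * M) ≤ L := by
    simp only [sub_zero, Real.exp_zero, integral_const, probReal_univ,
      smul_eq_mul, mul_one, Real.log_one, one_mul] at g3
    refine le_trans ?_ g3
    have := integral_mono (μ := μ) (integrable_const (-(s * M)))
      (integrable_of_measurable_of_abs_le hsF hsFM) fun x => (abs_le.1 (hsFM x)).1
    simpa using this
  have hI0 : I ≤ s * M * Z := by
    rw [hI, hZ, ← integral_const_mul]
    exact integral_mono iF (iE.const_mul _) fun x =>
      mul_le_mul_of_nonneg_right (le_of_abs_le (hsFM x)) (Real.exp_pos _).le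
  have hM0 : 0 ≤ M := by
    obtain ⟨x⟩ : Nonempty X := μ.nonempty_of_neZero
    exact (abs_nonneg _).trans (hFM x)
  have hE2 : E ≤ 2 * M * Z := by
    have h1 : -(s * M) * Z ≤ L * Z := mul_le_mul_of_nonneg_right hL0 hZ0.le
    have h2 : s * (M * Z) ≤ 1 * (M * Z) := mul_le_mul_of_nonneg_right hs1 (by positivity)
    linarith
  have hmono : -(1 - r / s) * I + r * κ * J ≤
      ∫ x, (r * F' x - s * F x) * Real.exp (s * F x) ∂μ := by
    rw [hI, hJ, ← integral_const_mul, ← integral_const_mul,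
      ← integral_add (iF.const_mul _) (iR.const_mul _)]
    refine integral_mono ((iF.const_mul _).add (iR.const_mul _)) iD fun x => ?_
    have h1 := mul_le_mul_of_nonneg_left (hcomp x) hr.le
    have h2 : r * F x = r / s * (s * F x) := by field_simp
    have h3 : -(1 - r / s) * (s * F x) + r * κ * R x ≤ r * F' x - s * F x := by linarith
    have h4 := mul_le_mul_of_nonneg_right h3 (Real.exp_pos (s * F x)).le
    simp only
    linarith
  have hJE : r * κ / B * E ≤ r * κ * J := by
    have := mul_le_mul_of_nonneg_left hent (show 0 ≤ r * κ / B by positivity)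
    refine this.trans_eq ?_
    field_simp
  have hIE : I = E + Z * L := by linarith
  have h1 := mul_le_mul_of_nonneg_right hδle hE0
  have h2 := mul_le_mul_of_nonneg_left hE2 hδ
  have h3 : Z * (r / s * L - 2 * M * δ) ≤ Z * L' := by
    rw [hIE] at hmono
    linarith
  have h4 := le_of_mul_le_mul_left h3 hZ0
  calc 1 / s * L = 1 / r * (r / s * L - 2 * M * δ) + 2 * M * δ / r := by field_simp; ring
    _ ≤ _ := by gcongr

/-- The second-order estimate behind the Herbst argument. -/
lemma neg_le_rpow_sub_div {D q β γ : ℝ} (hD : 0 < D) (hq : 0 < q) (hγ : 0 < γ) (hγβ : γ ≤ β) :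
    -((q * D / γ + q ^ 2 / γ ^ 2) * (β - γ) ^ 2 / (D * β)) ≤
      ((γ * (1 + D * β) / (β * (1 + D * γ))) ^ q - (γ / β) ^ q) / (D * β) -
        (1 - (γ * (1 + D * β) / (β * (1 + D * γ))) ^ q) := by
  have hβ : 0 < β := hγ.trans_le hγβ
  set x := q * Real.log (β / γ) with hx
  set y := q * Real.log ((1 + D * β) / (1 + D * γ)) with hy
  have h1β : 0 < 1 + D * β := by positivity
  have h1γ : 0 < 1 + D * γ := by positivity
  have e1 : (γ / β) ^ q = Real.exp (-x) := by
    rw [Real.rpow_def_of_pos (by positivity), hx, ← inv_div β γ, Real.log_inv]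
    ring_nf
  have e2 : (γ * (1 + D * β) / (β * (1 + D * γ))) ^ q = Real.exp (y - x) := by
    have : γ * (1 + D * β) / (β * (1 + D * γ)) =
      (β / γ)⁻¹ * ((1 + D * β) / (1 + D * γ)) := by field_simp
    rw [Real.rpow_def_of_pos (by positivity), this, Real.log_mul (by positivity) (by positivity),
      Real.log_inv, hx, hy]
    ring_nf
  rw [e1, e2]
  have hx0 : 0 ≤ x := mul_nonneg hq.le (Real.log_nonneg (by rw [le_div_iff₀ hγ]; linarith))
  have hx1 : x ≤ q * ((β - γ) / γ) := by
    rw [hx]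
    gcongr
    refine (Real.log_le_sub_one_of_pos (by positivity)).trans_eq ?_
    field_simp
  have hy1 : q * (D * (β - γ) / (1 + D * β)) ≤ y := by
    rw [hy]
    gcongr
    have := Real.one_sub_inv_le_log_of_pos (show 0 < (1 + D * β) / (1 + D * γ) by positivity)
    refine le_trans (le_of_eq ?_) this
    field_simp
    ring
  have hy2 : q * D * (β - γ) ≤ (1 + D * β) * y := by
    have := mul_le_mul_of_nonneg_left hy1 h1β.le
    refine le_trans (le_of_eq ?_) this
    field_simp
  have hE1 : 1 + (y - x) ≤ Real.exp (y - x) := by linarith [Real.add_one_le_exp (y - x)]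
  have hE2 : Real.exp (-x) ≤ 1 - x + x ^ 2 := by
    rw [Real.exp_neg]
    refine (inv_anti₀ (by linarith) (Real.add_one_le_exp x)).trans ?_
    rw [inv_le_iff_one_le_mul₀ (by linarith)]
    nlinarith [pow_nonneg hx0 3]
  have hxx : x ^ 2 ≤ (q * ((β - γ) / γ)) ^ 2 := pow_le_pow_left₀ hx0 hx1 2
  have h1 := mul_le_mul_of_nonneg_left hE1 h1β.le
  have h2 : D * β * x ≤ D * β * (q * ((β - γ) / γ)) := mul_le_mul_of_nonneg_left hx1 (by positivity)
  have main : -((q * D / γ + q ^ 2 / γ ^ 2) * (β - γ) ^ 2) ≤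
      (1 + D * β) * Real.exp (y - x) - Real.exp (-x) - D * β := by
    have e : q * D * (β - γ) - D * β * (q * ((β - γ) / γ)) - (q * ((β - γ) / γ)) ^ 2 =
        -((q * D / γ + q ^ 2 / γ ^ 2) * (β - γ) ^ 2) := by field_simp; ring
    rw [← e]
    linarith
  have hDβ : 0 < D * β := by positivity
  calc _ = -((q * D / γ + q ^ 2 / γ ^ 2) * (β - γ) ^ 2) / (D * β) := by rw [neg_div]
    _ ≤ ((1 + D * β) * Real.exp (y - x) - Real.exp (-x) - D * β) / (D * β) := by gcongr
    _ = _ := by field_simp; ring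

lemma log_integral_exp_le {μ : Measure X} [IsProbabilityMeasure μ] {F : X → ℝ} {M t : ℝ}
    (hF : Measurable F) (hM : ∀ x, |F x| ≤ M) (ht : 0 < t) (htM : t * M ≤ 1) :
    1 / t * Real.log (∫ x, Real.exp (t * F x) ∂μ) ≤ ∫ x, F x ∂μ + t * M ^ 2 := by
  have htF : ∀ x, |t * F x| ≤ t * M := fun x => by
    rw [abs_mul, abs_of_pos ht]; exact mul_le_mul_of_nonneg_left (hM x) ht.le
  have iE := integrable_exp (μ := μ) (hF.const_mul t) htF
  have iF := integrable_of_measurable_of_abs_le (μ := μ) hF hM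
  have h1 : ∫ x, Real.exp (t * F x) ∂μ ≤ ∫ x, (1 + t * F x + (t * M) ^ 2) ∂μ := by
    refine integral_mono iE (((integrable_const _).add (iF.const_mul t)).add
      (integrable_const _)) fun x => ?_
    have h2 := Real.abs_exp_sub_one_sub_id_le ((htF x).trans htM)
    have h3 : (t * F x) ^ 2 ≤ (t * M) ^ 2 := by
      rw [← sq_abs (t * F x)]
      exact pow_le_pow_left₀ (abs_nonneg _) (htF x) 2
    have := le_of_abs_le h2
    simp only
    linarith
  have iadd : Integrable (fun x => 1 + t * F x) μ := (integrable_const _).add (iF.const_mul t)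
  rw [integral_add iadd (integrable_const _),
    integral_add (integrable_const _) (iF.const_mul t), integral_const_mul] at h1
  simp only [integral_const, probReal_univ, smul_eq_mul, one_mul] at h1
  have h2 := Real.log_le_sub_one_of_pos (integral_exp_pos iE)
  rw [one_div, inv_mul_le_iff₀ ht]
  nlinarith

end Herbst

section TauLSIImplies

variable {X : Type*} [MetricSpace X] [MeasurableSpace X] {α : ℝ → ℝ}

lemma TauLSI.max_one {μ : Measure X} [IsProbabilityMeasure μ] (hα : IsYoung α) {lam A : ℝ}
    (hlam : 0 < lam) (h : TauLSI μ α lam A) : TauLSI μ α lam (max A 1) := by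
  intro f hf hfL
  obtain ⟨M, hM⟩ := hf
  refine (h f ⟨M, hM⟩ hfL).trans (mul_le_mul_of_nonneg_right (le_max_left _ _) ?_)
  exact integral_nonneg fun x =>
    mul_nonneg (sub_nonneg.2 (QInf_le_self hα hlam.le hM x)) (Real.exp_pos _).le

variable [BorelSpace X]

lemma measurable_QInf (hα : IsYoung α) {lam M : ℝ} (hlam : 0 < lam) {f : X → ℝ}
    (hf : ∀ x, |f x| ≤ M) : Measurable (QInf α lam f) :=
  (locallyLipschitz_QInf hα hlam hf).continuous.measurable

lemma measurable_supConv (hα : IsYoung α) {a M : ℝ} (ha : 0 < a) {g : X → ℝ}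
    (hg : ∀ x, |g x| ≤ M) : Measurable (supConv α a g) :=
  (measurable_QInf hα ha (f := fun y => -g y) (M := M) (by simpa using hg)).neg

/-- The dual form of the transport-entropy inequality, obtained from the `(τ)`-log-Sobolev
inequality by the Herbst argument along sup-convolutions. -/
lemma TauLSI.log_integral_exp_le_integral_supConv {μ : Measure X} [IsProbabilityMeasure μ]
    (hα : IsYoung α) (hΔ : DeltaTwo α) {lam B b : ℝ} (hlam : 0 < lam) (hB : 0 < B)
    (hb : 0 < b) (hb1 : b < 1) (h : TauLSI μ α lam B) {g : X → ℝ} (hg : Continuous g) {M : ℝ}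
    (hM : ∀ x, |g x| ≤ M) :
    Real.log (∫ x, Real.exp (g x) ∂μ) ≤ ∫ x, supConv α (lam *
      (b / (1 + B * ((1 - b) ^ (-(pAlpha α - 1)) - 1))) ^ (pAlpha α - 1)) g x ∂μ := by
  have hp := hα.one_lt_pAlpha hΔ
  set q := pAlpha α - 1 with hq
  have hq0 : 0 < q := by linarith
  have hc : 0 < (1 - b) ^ (-q) - 1 := by
    rw [sub_pos]
    exact Real.one_lt_rpow_of_pos_of_lt_one_of_neg (by linarith) (by linarith) (by linarith)
  set c := ((1 - b) ^ (-q) - 1) / b with hcdef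
  have hc0 : 0 < c := div_pos hc hb
  set D := B * c with hDdef
  have hD : 0 < D := by positivity
  have hDb : B * ((1 - b) ^ (-q) - 1) = D * b := by rw [hDdef, hcdef]; field_simp
  rw [hDb]
  set k := b / (1 + D * b) with hk
  have hk0 : 0 < k := by positivity
  set av : ℝ → ℝ := fun β => lam * (k * (1 + D * β)) ^ q with hav
  set tv : ℝ → ℝ := fun β => (β / (k * (1 + D * β))) ^ q with htv
  have av_pos : ∀ β, 0 ≤ β → 0 < av β := fun β hβ => by simp only [hav]; positivity
  have tv_pos : ∀ β, 0 < β → 0 < tv β := fun β hβ => by simp only [htv]; positivity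
  have av_mono : ∀ γ β, 0 ≤ γ → γ ≤ β → av γ ≤ av β := fun γ β hγ hγβ => by
    simp only [hav]; gcongr
  have tv_mono : ∀ γ β, 0 ≤ γ → γ ≤ β → tv γ ≤ tv β := fun γ β hγ hγβ => by
    have hβ := hγ.trans hγβ
    simp only [htv]
    refine Real.rpow_le_rpow (by positivity) ?_ hq0.le
    rw [div_le_div_iff₀ (by positivity) (by positivity)]
    nlinarith
  have tv_mul_av : ∀ β, 0 < β → tv β * av β = lam * β ^ q := fun β hβ => by
    simp only [htv, hav]
    rw [mul_left_comm, ← Real.mul_rpow (by positivity) (by positivity)]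
    congr 2
    field_simp
  have tv_b : tv b = 1 := by
    have : b / (k * (1 + D * b)) = 1 := by rw [hk]; field_simp
    simp only [htv, this, Real.one_rpow]
  set Γ : ℝ → ℝ := fun β =>
    1 / tv β * Real.log (∫ x, Real.exp (tv β * supConv α (av β) g x) ∂μ) with hΓ
  have hM0 : 0 ≤ M := by
    obtain ⟨x⟩ : Nonempty X := μ.nonempty_of_neZero
    exact (abs_nonneg _).trans (hM x)
  have mono : ∀ β₀, 0 < β₀ → β₀ ≤ b → Γ b ≤ Γ β₀ := by
    intro β₀ hβ₀ hβ₀b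
    refine le_of_forall_le_add_mul_sq (K := 2 * M *
      ((q * D / β₀ + q ^ 2 / β₀ ^ 2) / (D * β₀)) / tv β₀) hβ₀b fun γ β hγ0 hγβ hβb => ?_
    have hγ : 0 < γ := hβ₀.trans_le hγ0
    have hβ : 0 < β := hγ.trans_le hγβ
    have hβq : 0 < β ^ q := Real.rpow_pos_of_pos hβ _
    have hFM := abs_supConv_le hα (av_pos β hβ.le).le hM
    have hsFM : ∀ x, |tv β * supConv α (av β) g x| ≤ tv β * M := fun x => by
      rw [abs_mul, abs_of_pos (tv_pos β hβ)]
      exact mul_le_mul_of_nonneg_left (hFM x) (tv_pos β hβ).le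
    have hratio : tv γ / tv β = (γ * (1 + D * β) / (β * (1 + D * γ))) ^ q := by
      simp only [htv]
      rw [← Real.div_rpow (by positivity) (by positivity)]
      congr 1
      field_simp
    have hstep := log_integral_exp_step (μ := μ) (F := supConv α (av β) g)
      (F' := supConv α (av γ) g)
      (R := fun x => tv β * supConv α (av β) g x -
        QInf α lam (fun z => tv β * supConv α (av β) g z) x)
      (M := M) (N := tv β * M + tv β * M) (r := tv γ) (s := tv β)
      (κ := (av β - av γ) / (lam * (c * β * β ^ q))) (B := B)
      (δ := (q * D / γ + q ^ 2 / γ ^ 2) * (β - γ) ^ 2 / (D * β))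
      (measurable_supConv hα (av_pos β hβ.le) hM) hFM
      (measurable_supConv hα (av_pos γ hγ.le) hM)
      (abs_supConv_le hα (av_pos γ hγ.le).le hM)
      (((measurable_supConv hα (av_pos β hβ.le) hM).const_mul _).sub
        (measurable_QInf hα hlam hsFM))
      (fun x => (abs_sub _ _).trans (add_le_add (hsFM x) (abs_QInf_le hα hlam.le hsFM x)))
      (tv_pos γ hγ) (tv_pos β hβ) (tv_b ▸ tv_mono β b hβ.le hβb)
      (div_nonneg (sub_nonneg.2 (av_mono γ β hγ.le hγβ)) (by positivity)) hB (by positivity)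
      (fun x => supConv_add_le_supConv hα hΔ hM hlam hb1 hβ hβb (tv_pos β hβ)
        (av_pos γ hγ.le).le (av_mono γ β hγ.le hγβ) (tv_mul_av β hβ) x)
      (h _ ⟨_, hsFM⟩ (locallyLipschitz_mul_supConv hα (av_pos β hβ.le) hM _)) ?_
    · refine hstep.trans (add_le_add_right ?_ _)
      have h1 : tv β₀ ≤ tv γ := tv_mono _ _ hβ₀.le hγ0
      have h2 : 0 < tv β₀ := tv_pos _ hβ₀
      have h3 : β₀ ≤ β := hγ0.trans hγβ
      calc 2 * M * ((q * D / γ + q ^ 2 / γ ^ 2) * (β - γ) ^ 2 / (D * β)) / tv γ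
          ≤ 2 * M * ((q * D / β₀ + q ^ 2 / β₀ ^ 2) * (β - γ) ^ 2 / (D * β₀)) / tv β₀ := by
            gcongr
        _ = _ := by ring
    · refine (neg_le_rpow_sub_div hD hq0 hγ hγβ).trans_eq ?_
      rw [← hratio]
      congr 1
      have e1 : tv γ * av β = tv γ / tv β * (lam * β ^ q) := by
        rw [← tv_mul_av β hβ]
        have := (tv_pos β hβ).ne'
        field_simp
      have e2 : (γ / β) ^ q = γ ^ q / β ^ q := Real.div_rpow hγ.le hβ.le _
      rw [mul_div_assoc', mul_sub, e1, tv_mul_av γ hγ, e2, hDdef]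
      field_simp
  have av0 : av 0 = lam * k ^ q := by simp [hav]
  rw [← av0]
  have top : Real.log (∫ x, Real.exp (g x) ∂μ) ≤ Γ b := by
    simp only [hΓ, tv_b, one_mul, div_one]
    refine Real.log_le_log (integral_exp_pos (integrable_exp hg.measurable hM)) ?_
    refine integral_mono (integrable_exp hg.measurable hM)
      (integrable_exp (measurable_supConv hα (av_pos b hb.le) hM)
        (abs_supConv_le hα (av_pos b hb.le).le hM)) fun x => ?_
    exact Real.exp_le_exp.2 (le_supConv hα (av_pos b hb.le).le hM x)
  have hlim : Tendsto tv (𝓝[>] 0) (𝓝 0) := by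
    have hcont : ContinuousAt tv 0 := by
      simp only [htv]
      refine ContinuousAt.rpow_const (ContinuousAt.div continuousAt_id (by fun_prop) ?_)
        (Or.inr hq0.le)
      simpa using hk0.ne'
    have h0 : tv 0 = 0 := by simp [htv, Real.zero_rpow hq0.ne']
    have := hcont.tendsto
    rw [h0] at this
    exact this.mono_left nhdsWithin_le_nhds
  set F₀ := supConv α (av 0) g with hF₀
  have hlim2 : Tendsto (fun β => ∫ x, F₀ x ∂μ + tv β * M ^ 2) (𝓝[>] 0)
      (𝓝 (∫ x, F₀ x ∂μ + 0 * M ^ 2)) := tendsto_const_nhds.add (hlim.mul_const _)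
  rw [zero_mul, add_zero] at hlim2
  refine ge_of_tendsto hlim2 ?_
  have hev : ∀ᶠ β in 𝓝[>] (0 : ℝ), tv β * M < 1 := by
    have := hlim.mul_const M
    rw [zero_mul] at this
    exact this.eventually_lt_const one_pos
  filter_upwards [hev, Ioo_mem_nhdsGT hb] with β hβM hβ
  refine (top.trans (mono β hβ.1 hβ.2.le)).trans ?_
  have hF₀m := measurable_supConv hα (av_pos 0 le_rfl) hM
  have hF₀M := abs_supConv_le hα (av_pos 0 le_rfl).le hM
  refine le_trans ?_ (log_integral_exp_le hF₀m hF₀M (tv_pos β hβ.1) hβM.le)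
  have ht := tv_pos β hβ.1
  have bd : ∀ {F : X → ℝ}, (∀ x, |F x| ≤ M) → ∀ x, |tv β * F x| ≤ tv β * M := fun hF x => by
    rw [abs_mul, abs_of_pos ht]
    exact mul_le_mul_of_nonneg_left (hF x) ht.le
  have i1 := integrable_exp (μ := μ)
    ((measurable_supConv hα (av_pos β hβ.1.le) hM).const_mul (tv β))
    (bd (abs_supConv_le hα (av_pos β hβ.1.le).le hM))
  have i2 := integrable_exp (μ := μ) (hF₀m.const_mul (tv β)) (bd hF₀M)
  simp only [hΓ]
  refine mul_le_mul_of_nonneg_left (Real.log_le_log (integral_exp_pos i1)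
    (integral_mono i1 i2 fun x => Real.exp_le_exp.2 (mul_le_mul_of_nonneg_left ?_ ht.le)))
    (by positivity)
  exact supConv_anti hα (av_pos 0 le_rfl).le (av_mono 0 β le_rfl hβ.1.le) hM x

end TauLSIImplies

section Duality

open scoped BoundedContinuousFunction CompactlySupported

/-- A positive linear functional on bounded continuous functions which is tight along a sequence
of compactly supported cutoff functions is the integral against a finite measure. -/
lemma exists_measure_of_positive_of_tight {Y : Type*} [TopologicalSpace Y] [T2Space Y]
    [LocallyCompactSpace Y] [MeasurableSpace Y] [BorelSpace Y]
    (L : (Y →ᵇ ℝ) →ₗ[ℝ] ℝ) (hL : ∀ φ : Y →ᵇ ℝ, (∀ y, 0 ≤ φ y) → 0 ≤ L φ)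
    (χ : ℕ → Y →ᵇ ℝ) (hχ0 : ∀ n y, 0 ≤ χ n y) (hχ1 : ∀ n y, χ n y ≤ 1)
    (hχc : ∀ n, HasCompactSupport (χ n)) (hχ : ∀ y, Tendsto (fun n => χ n y) atTop (𝓝 1))
    (htight : Tendsto (fun n => L (1 - χ n)) atTop (𝓝 0)) :
    ∃ π : Measure Y, IsFiniteMeasure π ∧ ∀ φ : Y →ᵇ ℝ, ∫ y, φ y ∂π = L φ := by
  have hmono : ∀ φ ψ : Y →ᵇ ℝ, (∀ y, φ y ≤ ψ y) → L φ ≤ L ψ := fun φ ψ h => by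
    have := hL (ψ - φ) fun y => by simpa using h y
    rw [map_sub] at this
    linarith
  let L₀ : C_c(Y, ℝ) →ₗ[ℝ] ℝ :=
    { toFun := fun f => L f.toBoundedContinuousFunction
      map_add' := fun f g => by rw [← map_add]; rfl
      map_smul' := fun r f => by rw [RingHom.id_apply, ← map_smul]; rfl }
  let Λ : C_c(Y, ℝ) →ₚ[ℝ] ℝ := PositiveLinearMap.mk₀ L₀ fun f hf => hL _ fun y => hf y
  set π := RealRMK.rieszMeasure Λ
  have hcut : ∀ (φ : Y →ᵇ ℝ) n, ∫ y, φ y * χ n y ∂π = L (φ * χ n) := fun φ n =>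
    RealRMK.integral_rieszMeasure Λ
      ⟨⟨fun y => φ y * χ n y, φ.continuous.mul (χ n).continuous⟩, (hχc n).mul_left⟩
  have hint : ∀ n, Integrable (fun y => χ n y) π := fun n =>
    (χ n).continuous.integrable_of_hasCompactSupport (hχc n)
  have hfin : IsFiniteMeasure π := by
    refine ⟨lt_of_le_of_lt ?_ (ENNReal.ofReal_lt_top (r := L 1))⟩
    calc π univ = ∫⁻ y, liminf (fun n => ENNReal.ofReal (χ n y)) atTop ∂π := by
          rw [← lintegral_one]
          refine lintegral_congr fun y => ?_
          rw [(ENNReal.tendsto_ofReal (hχ y)).liminf_eq, ENNReal.ofReal_one]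
      _ ≤ liminf (fun n => ∫⁻ y, ENNReal.ofReal (χ n y) ∂π) atTop :=
          lintegral_liminf_le fun n => (χ n).continuous.measurable.ennreal_ofReal
      _ ≤ liminf (fun _ : ℕ => ENNReal.ofReal (L 1)) atTop := by
          refine liminf_le_liminf (Eventually.of_forall fun n => ?_)
          rw [← ofReal_integral_eq_lintegral_ofReal (hint n) (ae_of_all _ (hχ0 n))]
          refine ENNReal.ofReal_le_ofReal ?_
          have := hcut 1 n
          simp only [BoundedContinuousFunction.coe_one, Pi.one_apply, one_mul] at this
          rw [this]
          exact hmono _ _ (by simpa using hχ1 n)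
      _ = ENNReal.ofReal (L 1) := by simp
  refine ⟨π, hfin, fun φ => ?_⟩
  have h₁ : Tendsto (fun n => ∫ y, φ y * χ n y ∂π) atTop (𝓝 (∫ y, φ y ∂π)) := by
    refine tendsto_integral_of_dominated_convergence (fun _ => ‖φ‖)
      (fun n => (φ.continuous.mul (χ n).continuous).aestronglyMeasurable) (integrable_const _)
      (fun n => ae_of_all _ fun y => ?_) (ae_of_all _ fun y => ?_)
    · rw [norm_mul, Real.norm_of_nonneg (hχ0 n y)]
      exact (mul_le_of_le_one_right (norm_nonneg _) (hχ1 n y)).trans (φ.norm_coe_le_norm y)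
    · simpa using (hχ y).const_mul (φ y)
  have h₂ : Tendsto (fun n => L (φ * χ n)) atTop (𝓝 (L φ)) := by
    rw [tendsto_iff_norm_sub_tendsto_zero]
    refine squeeze_zero (g := fun n => ‖φ‖ * L (1 - χ n)) (fun _ => norm_nonneg _) (fun n => ?_)
      (mul_zero ‖φ‖ ▸ htight.const_mul _)
    have key : ∀ y, |φ y * χ n y - φ y| ≤ ‖φ‖ * (1 - χ n y) := fun y => by
      rw [show φ y * χ n y - φ y = -(φ y * (1 - χ n y)) by ring, abs_neg, abs_mul,
        abs_of_nonneg (sub_nonneg.2 (hχ1 n y))]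
      exact mul_le_mul_of_nonneg_right (φ.norm_coe_le_norm y) (sub_nonneg.2 (hχ1 n y))
    have hsmul : ‖φ‖ * L (1 - χ n) = L (‖φ‖ • (1 - χ n)) := by rw [map_smul, smul_eq_mul]
    rw [← map_sub, Real.norm_eq_abs, abs_le, hsmul, ← map_neg]
    exact ⟨hmono _ _ fun y => by simpa using (abs_le.1 (key y)).1,
      hmono _ _ fun y => by simpa using (abs_le.1 (key y)).2⟩
  simp_rw [hcut] at h₁
  exact tendsto_nhds_unique h₁ h₂

/-- The Hahn-Banach step of Kantorovich duality: if the dual problem has value at most `T`, there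
is a positive linear functional with the prescribed marginals and with cost at most `T`. -/
lemma exists_linearMap_of_forall_dual_le {X : Type*} [TopologicalSpace X] [MeasurableSpace X]
    [BorelSpace X] {ν μ : Measure X} [IsProbabilityMeasure ν]
    [IsProbabilityMeasure μ] {c : X × X → ℝ} (hc : ∀ z, 0 ≤ c z) {T : ℝ}
    (h : ∀ u v : X →ᵇ ℝ, (∀ x y, u x + v y ≤ c (x, y)) → ∫ x, u x ∂ν + ∫ y, v y ∂μ ≤ T) :
    ∃ L : (X × X →ᵇ ℝ) →ₗ[ℝ] ℝ, ∀ (φ : X × X →ᵇ ℝ) (u v : X →ᵇ ℝ) (s : ℝ), 0 ≤ s →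
      (∀ x y, φ (x, y) ≤ u x + v y + s * c (x, y)) →
      L φ ≤ ∫ x, u x ∂ν + ∫ y, v y ∂μ + s * T := by
  let S : (X × X →ᵇ ℝ) → Set ℝ := fun φ => {r | ∃ (u v : X →ᵇ ℝ) (s : ℝ), 0 ≤ s ∧
    (∀ x y, φ (x, y) ≤ u x + v y + s * c (x, y)) ∧
    r = ∫ x, u x ∂ν + ∫ y, v y ∂μ + s * T}
  have hT : 0 ≤ T := by simpa using h 0 0 (by simpa using fun x y => hc (x, y))
  have hne : ∀ φ, (S φ).Nonempty := fun φ =>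
    ⟨_, BoundedContinuousFunction.const X ‖φ‖, 0, 0, le_rfl,
      fun x y => by simpa using φ.apply_le_norm (x, y), rfl⟩
  have hpos : ∀ (φ : X × X →ᵇ ℝ) (u v : X →ᵇ ℝ) (s : ℝ), 0 < s →
      (∀ x y, φ (x, y) ≤ u x + v y + s * c (x, y)) →
      -‖φ‖ ≤ ∫ x, u x ∂ν + ∫ y, v y ∂μ + s * T := by
    intro φ u v s hs huv
    have := h (-s⁻¹ • (u + BoundedContinuousFunction.const X ‖φ‖)) (-s⁻¹ • v) fun x y => by
      have h1 := huv x y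
      have h2 := (abs_le.1 (φ.norm_coe_le_norm (x, y))).1
      simp only [BoundedContinuousFunction.coe_smul, BoundedContinuousFunction.coe_add,
        Pi.add_apply, BoundedContinuousFunction.const_apply, smul_eq_mul]
      rw [show -s⁻¹ * (u x + ‖φ‖) + -s⁻¹ * v y = (-(u x + ‖φ‖ + v y)) / s by field_simp; ring,
        div_le_iff₀ hs]
      linarith
    simp only [BoundedContinuousFunction.coe_smul, BoundedContinuousFunction.coe_add,
        Pi.add_apply, BoundedContinuousFunction.const_apply, smul_eq_mul] at this
    rw [integral_const_mul, integral_const_mul, integral_add (u.integrable ν) (integrable_const _)]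
      at this
    simp only [integral_const, probReal_univ, one_smul] at this
    rw [show -s⁻¹ * (∫ x, u x ∂ν + ‖φ‖) + -s⁻¹ * ∫ y, v y ∂μ =
      (-(∫ x, u x ∂ν + ‖φ‖ + ∫ y, v y ∂μ)) / s by field_simp; ring, div_le_iff₀ hs] at this
    linarith
  have hlb : ∀ φ, ∀ r ∈ S φ, -‖φ‖ ≤ r := by
    rintro φ _ ⟨u, v, s, hs, huv, rfl⟩
    refine le_of_forall_pos_le_add fun ε hε => ?_
    have hT1 : 0 < T + 1 := by linarith
    have := hpos φ u v (s + ε / (T + 1)) (by positivity) fun x y => by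
      have := mul_nonneg (div_pos hε hT1).le (hc (x, y))
      linarith [huv x y]
    have h2 : ε / (T + 1) * T ≤ ε := by
      rw [div_mul_eq_mul_div, div_le_iff₀ hT1]
      nlinarith
    linarith
  have hle : ∀ (φ : X × X →ᵇ ℝ) (r : ℝ), r ∈ S φ → sInf (S φ) ≤ r := fun φ r hr =>
    csInf_le ⟨_, hlb φ⟩ hr
  have hsmul : ∀ t : ℝ, 0 < t → ∀ φ, sInf (S (t • φ)) ≤ t * sInf (S φ) := by
    intro t ht φ
    rw [← div_le_iff₀' ht]
    refine le_csInf (hne φ) ?_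
    rintro _ ⟨u, v, s, hs, huv, rfl⟩
    rw [div_le_iff₀' ht]
    refine hle _ _ ⟨t • u, t • v, t * s, by positivity, fun x y => ?_, ?_⟩
    · have := mul_le_mul_of_nonneg_left (huv x y) ht.le
      simp only [BoundedContinuousFunction.coe_smul, smul_eq_mul]
      linarith
    · simp only [BoundedContinuousFunction.coe_smul, smul_eq_mul]
      rw [integral_const_mul, integral_const_mul]
      ring
  obtain ⟨L, -, hL⟩ := exists_extension_of_le_sublinear (⊥ : (X × X →ᵇ ℝ) →ₗ.[ℝ] ℝ)
    (fun φ => sInf (S φ)) (fun t ht φ => by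
      refine le_antisymm (hsmul t ht φ) ?_
      have := hsmul t⁻¹ (inv_pos.2 ht) (t • φ)
      rwa [smul_smul, inv_mul_cancel₀ ht.ne', one_smul, inv_mul_eq_div, le_div_iff₀' ht] at this)
    (fun φ ψ => by
      rw [← sub_le_iff_le_add]
      refine le_csInf (hne φ) ?_
      rintro _ ⟨u, v, s, hs, huv, rfl⟩
      rw [sub_le_comm]
      refine le_csInf (hne ψ) ?_
      rintro _ ⟨u', v', s', hs', huv', rfl⟩
      rw [sub_le_iff_le_add]
      refine hle _ _ ⟨u + u', v + v', s + s', by positivity, fun x y => ?_, ?_⟩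
      · simp only [BoundedContinuousFunction.coe_add, Pi.add_apply]
        linarith [huv x y, huv' x y]
      · simp only [BoundedContinuousFunction.coe_add, Pi.add_apply]
        rw [integral_add (u.integrable ν) (u'.integrable ν),
          integral_add (v.integrable μ) (v'.integrable μ)]
        ring)
    (by
      rintro ⟨φ, hφ⟩
      obtain rfl : φ = 0 := (Submodule.mem_bot ℝ).1 hφ
      have h0 : (⊥ : (X × X →ᵇ ℝ) →ₗ.[ℝ] ℝ) ⟨0, hφ⟩ = 0 := LinearPMap.map_zero _
      rw [h0]
      exact le_csInf (hne 0) (by simpa using hlb 0))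
  exact ⟨L, fun φ u v s hs huv => (hL φ).trans (hle _ _ ⟨u, v, s, hs, huv, rfl⟩)⟩

/-- **Kantorovich duality** for a nonnegative continuous cost: if the dual problem has value at
most `T`, some coupling has cost at most `T`. -/
lemma exists_coupling_of_forall_dual_le {X : Type*} [MetricSpace X] [ProperSpace X]
    [MeasurableSpace X] [BorelSpace X] {ν μ : Measure X} [IsProbabilityMeasure ν]
    [IsProbabilityMeasure μ] {c : X × X → ℝ} (hcc : Continuous c) (hc : ∀ z, 0 ≤ c z) {T : ℝ}
    (h : ∀ u v : X →ᵇ ℝ, (∀ x y, u x + v y ≤ c (x, y)) → ∫ x, u x ∂ν + ∫ y, v y ∂μ ≤ T) :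
    ∃ π : Measure (X × X), π.map Prod.fst = ν ∧ π.map Prod.snd = μ ∧
      ∫⁻ z, ENNReal.ofReal (c z) ∂π ≤ ENNReal.ofReal T := by
  obtain ⟨L, hL⟩ := exists_linearMap_of_forall_dual_le hc h
  let pr₁ : (X →ᵇ ℝ) → (X × X →ᵇ ℝ) := fun u => u.compContinuous ⟨Prod.fst, continuous_fst⟩
  let pr₂ : (X →ᵇ ℝ) → (X × X →ᵇ ℝ) := fun u => u.compContinuous ⟨Prod.snd, continuous_snd⟩
  have hle : ∀ (φ : X × X →ᵇ ℝ) (u v : X →ᵇ ℝ), (∀ x y, φ (x, y) ≤ u x + v y) →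
      L φ ≤ ∫ x, u x ∂ν + ∫ y, v y ∂μ := fun φ u v huv => by
    simpa using hL φ u v 0 le_rfl (by simpa using huv)
  have hpos : ∀ φ : X × X →ᵇ ℝ, (∀ z, 0 ≤ φ z) → 0 ≤ L φ := fun φ hφ => by
    simpa using hle (-φ) 0 0 fun x y => by simpa using hφ (x, y)
  have hfst : ∀ u, L (pr₁ u) = ∫ x, u x ∂ν := fun u => by
    refine le_antisymm (by simpa using hle (pr₁ u) u 0 (by simp [pr₁])) ?_
    simpa [integral_neg] using hle (-pr₁ u) (-u) 0 (by simp [pr₁])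
  have hsnd : ∀ v, L (pr₂ v) = ∫ y, v y ∂μ := fun v => by
    refine le_antisymm (by simpa using hle (pr₂ v) 0 v (by simp [pr₂])) ?_
    simpa [integral_neg] using hle (-pr₂ v) 0 (-v) (by simp [pr₂])
  obtain ⟨x₀⟩ : Nonempty X := nonempty_of_isProbabilityMeasure ν
  let ψ : ℕ → X →ᵇ ℝ := fun n => BoundedContinuousFunction.ofNormedAddCommGroup
    (fun x => max 0 (min 1 (n - dist x x₀))) (by fun_prop) 1 fun x => by
      rw [Real.norm_of_nonneg (le_max_left _ _)]
      exact max_le zero_le_one (min_le_left _ _)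
  have hψ0 : ∀ n x, 0 ≤ ψ n x := fun n x => le_max_left _ _
  have hψ1 : ∀ n x, ψ n x ≤ 1 := fun n x => max_le zero_le_one (min_le_left _ _)
  have hψlim : ∀ x, Tendsto (fun n => ψ n x) atTop (𝓝 1) := fun x => by
    refine tendsto_const_nhds.congr' ?_
    obtain ⟨N, hN⟩ := exists_nat_ge (dist x x₀ + 1)
    filter_upwards [eventually_ge_atTop N] with n hn
    have : (N : ℝ) ≤ n := by exact_mod_cast hn
    change 1 = max 0 (min 1 (n - dist x x₀))
    rw [min_eq_left (by linarith), max_eq_right zero_le_one]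
  have hψsupp : ∀ n x, ψ n x ≠ 0 → x ∈ Metric.closedBall x₀ n := fun n x hx => by
    by_contra hx'
    rw [Metric.mem_closedBall, not_le] at hx'
    exact hx (max_eq_left ((min_le_right _ _).trans (by linarith)))
  have hψint : ∀ ρ : Measure X, IsProbabilityMeasure ρ →
      Tendsto (fun n => ∫ x, (1 - ψ n) x ∂ρ) atTop (𝓝 0) := fun ρ _ => by
    have : Tendsto (fun n => ∫ x, (1 - ψ n) x ∂ρ) atTop (𝓝 (∫ _, (0 : ℝ) ∂ρ)) := by
      refine tendsto_integral_of_dominated_convergence (fun _ => 1)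
        (fun n => (1 - ψ n).continuous.aestronglyMeasurable) (integrable_const _)
        (fun n => ae_of_all _ fun x => ?_) (ae_of_all _ fun x => ?_)
      · simp only [BoundedContinuousFunction.coe_sub, BoundedContinuousFunction.coe_one,
          Pi.sub_apply, Pi.one_apply]
        rw [Real.norm_of_nonneg (sub_nonneg.2 (hψ1 n x))]
        linarith [hψ0 n x]
      · simpa using (hψlim x).const_sub 1
    simpa using this
  obtain ⟨π, hfin, hπ⟩ := exists_measure_of_positive_of_tight L hpos
    (fun n => pr₁ (ψ n) * pr₂ (ψ n)) (fun n z => mul_nonneg (hψ0 n _) (hψ0 n _))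
    (fun n z => mul_le_one₀ (hψ1 n _) (hψ0 n _) (hψ1 n _))
    (fun n => HasCompactSupport.intro
      ((isCompact_closedBall x₀ (n : ℝ)).prod (isCompact_closedBall x₀ (n : ℝ))) fun z hz => by
        by_contra hne
        exact hz ⟨hψsupp n _ (left_ne_zero_of_mul hne), hψsupp n _ (right_ne_zero_of_mul hne)⟩)
    (fun z => by simpa [pr₁, pr₂] using (hψlim z.1).mul (hψlim z.2))
    (by
      refine squeeze_zero (fun n => hpos _ fun z => sub_nonneg.2
        (mul_le_one₀ (hψ1 n _) (hψ0 n _) (hψ1 n _))) (fun n => hle _ (1 - ψ n) (1 - ψ n) fun x y =>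
          ?_) (by simpa using (hψint ν inferInstance).add (hψint μ inferInstance))
      change 1 - ψ n x * ψ n y ≤ (1 - ψ n x) + (1 - ψ n y)
      nlinarith [mul_nonneg (sub_nonneg.2 (hψ1 n x)) (sub_nonneg.2 (hψ1 n y))])
  refine ⟨π, ?_, ?_, ?_⟩
  · refine ext_of_forall_integral_eq_of_IsFiniteMeasure fun u => ?_
    rw [integral_map measurable_fst.aemeasurable u.continuous.aestronglyMeasurable, ← hfst, ← hπ]
    rfl
  · refine ext_of_forall_integral_eq_of_IsFiniteMeasure fun v => ?_
    rw [integral_map measurable_snd.aemeasurable v.continuous.aestronglyMeasurable, ← hsnd, ← hπ]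
    rfl
  · let φ : ℕ → X × X →ᵇ ℝ := fun n => BoundedContinuousFunction.ofNormedAddCommGroup
      (fun z => min (c z) n) (by fun_prop) n fun z => by
        rw [Real.norm_of_nonneg (le_min (hc z) n.cast_nonneg)]
        exact min_le_right _ _
    have hφ : ∀ z, Tendsto (fun n => φ n z) atTop (𝓝 (c z)) := fun z => by
      refine tendsto_const_nhds.congr' ?_
      obtain ⟨N, hN⟩ := exists_nat_ge (c z)
      filter_upwards [eventually_ge_atTop N] with n hn
      exact (min_eq_left (hN.trans (by exact_mod_cast hn))).symm
    calc ∫⁻ z, ENNReal.ofReal (c z) ∂π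
        = ∫⁻ z, liminf (fun n => ENNReal.ofReal (φ n z)) atTop ∂π :=
          lintegral_congr fun z => (ENNReal.tendsto_ofReal (hφ z)).liminf_eq.symm
      _ ≤ liminf (fun n => ∫⁻ z, ENNReal.ofReal (φ n z) ∂π) atTop :=
          lintegral_liminf_le fun n => (φ n).continuous.measurable.ennreal_ofReal
      _ ≤ liminf (fun _ : ℕ => ENNReal.ofReal T) atTop := by
          refine liminf_le_liminf (Eventually.of_forall fun n => ?_)
          rw [← ofReal_integral_eq_lintegral_ofReal ((φ n).integrable π)
            (ae_of_all _ fun z => le_min (hc z) n.cast_nonneg), hπ]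
          refine ENNReal.ofReal_le_ofReal ?_
          have hn : ∀ z, φ n z ≤ c z := fun z => min_le_left _ _
          simpa using hL (φ n) 0 0 1 zero_le_one fun x y => by simpa using hn (x, y)
      _ = ENNReal.ofReal T := by simp

end Duality

section Equivalence

variable {X : Type*} [MetricSpace X] [MeasurableSpace X] {α : ℝ → ℝ}

lemma ofReal_mul_top_of_pos {C : ℝ} (hC : 0 < C) : ENNReal.ofReal C * ⊤ = ⊤ :=
  ENNReal.mul_top (by simpa using hC)

/-- The Donsker-Varadhan inequality for bounded functions. -/
lemma integral_le_integral_llr_add_log {Y : Type*} [MeasurableSpace Y] {ν μ : Measure Y}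
    [IsProbabilityMeasure ν] [IsProbabilityMeasure μ] (hνμ : ν ≪ μ)
    (hint : Integrable (llr ν μ) ν) {g : Y → ℝ} (hg : Measurable g) {M : ℝ}
    (hM : ∀ x, |g x| ≤ M) :
    ∫ x, g x ∂ν ≤ ∫ x, llr ν μ x ∂ν + Real.log (∫ x, Real.exp (g x) ∂μ) := by
  have hgν := integrable_of_measurable_of_abs_le (μ := ν) hg hM
  have hexp := integrable_exp (μ := μ) hg hM
  have := isProbabilityMeasure_tilted hexp
  have h := InformationTheory.integral_llr_add_sub_measure_univ_nonneg
    (hνμ.trans (absolutelyContinuous_tilted hexp)) (integrable_llr_tilted_right hνμ hgν hint hexp)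
  rw [integral_llr_tilted_right hνμ hgν hexp hint] at h
  simp only [probReal_univ] at h
  linarith

variable [BorelSpace X]

/-- The dual form of the transport-entropy inequality implies the inequality itself. -/
lemma transportEntropy_of_log_integral_exp_le [ProperSpace X] {μ : Measure X}
    [IsProbabilityMeasure μ] (hα : IsYoung α) {C : ℝ} (hC : 0 < C)
    (h : ∀ g : X → ℝ, Continuous g → IsBoundedFun g →
      Real.log (∫ x, Real.exp (g x) ∂μ) ≤ ∫ x, supConv α (1 / C) g x ∂μ) :
    TransportEntropy μ α C := by
  intro ν _
  unfold relEnt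
  split_ifs with hν
  swap
  · rw [ofReal_mul_top_of_pos hC]
    exact le_top
  obtain ⟨hνμ, hint⟩ := hν
  rw [← ENNReal.ofReal_mul hC.le]
  obtain ⟨π, h₁, h₂, hπ⟩ := exists_coupling_of_forall_dual_le (ν := ν) (μ := μ)
    (c := fun z => α (dist z.1 z.2)) (T := C * ∫ x, llr ν μ x ∂ν)
    (hα.continuous.comp continuous_dist) (fun z => hα.nonneg _) fun u v huv => by
    have hM : ∀ x, |C⁻¹ * u x| ≤ C⁻¹ * ‖u‖ := fun x => by
      rw [abs_mul, abs_of_pos (inv_pos.2 hC)]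
      exact mul_le_mul_of_nonneg_left (u.norm_coe_le_norm x) (inv_pos.2 hC).le
    have hg : Continuous fun x => C⁻¹ * u x := by fun_prop
    have h1 := integral_le_integral_llr_add_log hνμ hint hg.measurable hM
    have h2 := h _ hg ⟨_, hM⟩
    have h3 : ∫ x, supConv α (1 / C) (fun x => C⁻¹ * u x) x ∂μ ≤ ∫ y, -(C⁻¹ * v y) ∂μ := by
      refine integral_mono (integrable_of_measurable_of_abs_le
        (measurable_supConv hα (one_div_pos.2 hC) hM)
        (fun x => abs_supConv_le hα (one_div_pos.2 hC).le hM x))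
        ((v.integrable μ).const_mul _).neg fun y => supConv_le fun x => ?_
      have := mul_le_mul_of_nonneg_left (huv x y) (inv_pos.2 hC).le
      rw [dist_comm y x, one_div]
      dsimp only at this
      linarith
    rw [integral_const_mul] at h1
    rw [integral_neg, integral_const_mul] at h3
    have h4 : C⁻¹ * (∫ x, u x ∂ν + ∫ y, v y ∂μ) ≤ ∫ x, llr ν μ x ∂ν := by linarith
    rwa [inv_mul_le_iff₀ hC] at h4
  exact le_trans (sInf_le (a := ∫⁻ z, ENNReal.ofReal (α (dist z.1 z.2)) ∂π) ⟨π, h₁, h₂, rfl⟩) hπ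

/-- The constant obtained from the Herbst argument at `b = 1 / p` dominates the inverse of the
transport-entropy constant. -/
lemma inv_le_mul_div_rpow {p lam B : ℝ} (hp : 1 < p) (hlam : 0 < lam) (hB : 1 ≤ B) :
    1 / ((1 / lam) * (p ^ (p * (p - 1)) / (p - 1) ^ ((p - 1) * (p - 1))) * B ^ (p - 1)) ≤
      lam * (1 / p / (1 + B * ((1 - 1 / p) ^ (-(p - 1)) - 1))) ^ (p - 1) := by
  have hp0 : 0 < p := by linarith
  set q := p - 1 with hq
  have hq0 : 0 < q := by linarith
  have hB0 : 0 < B := by linarith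
  have h1b : 1 - 1 / p = q / p := by rw [hq]; field_simp
  have hk : 1 < (q / p) ^ (-q) :=
    Real.one_lt_rpow_of_pos_of_lt_one_of_neg (by positivity)
      (by rw [div_lt_one hp0]; linarith) (by linarith)
  have hk' : (q / p) ^ (-q) = p ^ q / q ^ q := by
    rw [Real.rpow_neg (by positivity), Real.div_rpow hq0.le hp0.le, inv_div]
  have hpq : p * p ^ q = p ^ p := by
    rw [hq, Real.rpow_sub_one hp0.ne']; field_simp
  have hle : q ^ q / p ^ p / B ≤ 1 / p / (1 + B * ((1 - 1 / p) ^ (-q) - 1)) := by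
    rw [h1b]
    calc q ^ q / p ^ p / B = 1 / p / (B * (q / p) ^ (-q)) := by
          rw [hk', ← hpq]
          have := Real.rpow_pos_of_pos hp0 q
          have := Real.rpow_pos_of_pos hq0 q
          field_simp
      _ ≤ _ := by
          refine div_le_div_of_nonneg_left (by positivity) ?_ (by linarith)
          nlinarith
  calc _ = lam * (q ^ q / p ^ p / B) ^ q := by
        rw [Real.div_rpow (by positivity) hB0.le, Real.div_rpow (by positivity) (by positivity),
          ← Real.rpow_mul hq0.le, ← Real.rpow_mul hp0.le]
        field_simp
    _ ≤ _ := mul_le_mul_of_nonneg_left (Real.rpow_le_rpow (by positivity) hle hq0.le) hlam.le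

lemma transportConst_pos {p lam A : ℝ} (hp : 1 < p) (hlam : 0 < lam) :
    0 < (1 / lam) * (p ^ (p * (p - 1)) / (p - 1) ^ ((p - 1) * (p - 1))) * max A 1 ^ (p - 1) := by
  have h1 : 0 < p - 1 := by linarith
  have h2 : 0 < max A 1 := lt_max_of_lt_right one_pos
  positivity

theorem TauLSI.transportEntropy [ProperSpace X] {μ : Measure X} [IsProbabilityMeasure μ]
    (hα : IsYoung α) (hΔ : DeltaTwo α) {lam A : ℝ} (hlam : 0 < lam) (h : TauLSI μ α lam A) :
    TransportEntropy μ α ((1 / lam) * (pAlpha α ^ (pAlpha α * (pAlpha α - 1)) /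
      (pAlpha α - 1) ^ ((pAlpha α - 1) * (pAlpha α - 1))) * max A 1 ^ (pAlpha α - 1)) := by
  have hp := hα.one_lt_pAlpha hΔ
  have hC := transportConst_pos (A := A) hp hlam
  have hB : 1 ≤ max A 1 := le_max_right _ _
  refine transportEntropy_of_log_integral_exp_le hα hC fun g hg ⟨M, hM⟩ => ?_
  have hp0 : 0 < pAlpha α := by linarith
  have h1 := TauLSI.log_integral_exp_le_integral_supConv hα hΔ hlam (zero_lt_one.trans_le hB)
    (one_div_pos.2 hp0) ((div_lt_one hp0).2 hp) (h.max_one hα hlam) hg hM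
  have hle := inv_le_mul_div_rpow hp hlam hB
  have hC' := one_div_pos.2 hC
  exact h1.trans (integral_mono
    (integrable_of_measurable_of_abs_le (measurable_supConv hα (hC'.trans_le hle) hM)
      fun x => abs_supConv_le hα (hC'.trans_le hle).le hM x)
    (integrable_of_measurable_of_abs_le (measurable_supConv hα hC' hM)
      fun x => abs_supConv_le hα hC'.le hM x)
    fun x => supConv_anti hα hC'.le hle hM x)

/-- A coupling bounds the difference of the integrals of `f` by its cost. -/
lemma integral_sub_integral_le_of_coupling [SecondCountableTopology X] {ν μ : Measure X}
    [IsProbabilityMeasure ν] [IsProbabilityMeasure μ] (hα : IsYoung α) {lam M : ℝ}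
    (hlam : 0 < lam) {f : X → ℝ} (hf : Measurable f) (hM : ∀ x, |f x| ≤ M)
    {π : Measure (X × X)} (h₁ : π.map Prod.fst = ν) (h₂ : π.map Prod.snd = μ) {t : ℝ}
    (ht : 0 ≤ t) (hcost : ∫⁻ z, ENNReal.ofReal (α (dist z.1 z.2)) ∂π ≤ ENNReal.ofReal t) :
    ∫ x, QInf α lam f x ∂ν - ∫ x, f x ∂μ ≤ lam * t := by
  have hQ := measurable_QInf hα hlam hM
  have hprob : IsProbabilityMeasure π := by
    refine ⟨?_⟩
    rw [← Set.preimage_univ (f := Prod.fst), ← Measure.map_apply measurable_fst .univ, h₁,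
      measure_univ]
  have hcm : Measurable fun z : X × X => α (dist z.1 z.2) :=
    (hα.continuous.comp continuous_dist).measurable
  have hci : Integrable (fun z : X × X => α (dist z.1 z.2)) π := by
    refine ⟨hcm.aestronglyMeasurable, ?_⟩
    rw [hasFiniteIntegral_iff_ofReal (ae_of_all _ fun z => hα.nonneg _)]
    exact hcost.trans_lt ENNReal.ofReal_lt_top
  have hcle : ∫ z, α (dist z.1 z.2) ∂π ≤ t := by
    rw [integral_eq_lintegral_of_nonneg_ae (ae_of_all _ fun z => hα.nonneg _)
      hcm.aestronglyMeasurable]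
    exact ENNReal.toReal_le_of_le_ofReal ht hcost
  have hQπ : Integrable (fun z : X × X => QInf α lam f z.1) π :=
    integrable_of_measurable_of_abs_le (hQ.comp measurable_fst)
      fun z => abs_QInf_le hα hlam.le hM z.1
  have hfπ : Integrable (fun z : X × X => f z.2) π :=
    integrable_of_measurable_of_abs_le (hf.comp measurable_snd) fun z => hM z.2
  rw [← h₁, ← h₂, integral_map measurable_fst.aemeasurable hQ.aestronglyMeasurable,
    integral_map measurable_snd.aemeasurable hf.aestronglyMeasurable, ← integral_sub hQπ hfπ]
  calc _ ≤ ∫ z, lam * α (dist z.1 z.2) ∂π :=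
        integral_mono (hQπ.sub hfπ) (hci.const_mul _) fun z => by
          have := QInf_le_add hα hlam.le hM z.1 z.2
          rw [Pi.sub_apply]
          linarith
    _ ≤ lam * t := by
        rw [integral_const_mul]
        exact mul_le_mul_of_nonneg_left hcle hlam.le

theorem TransportEntropy.tauLSI [SecondCountableTopology X] {μ : Measure X}
    [IsProbabilityMeasure μ] (hα : IsYoung α) {C lam : ℝ} (hC : 0 < C)
    (h : TransportEntropy μ α C) (hlam : 0 < lam) (hlamC : lam < 1 / C) :
    TauLSI μ α lam (1 / (1 - lam * C)) := by
  rintro f ⟨M, hM⟩ hfL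
  have hf := hfL.continuous.measurable
  have hlC : 0 < 1 - lam * C := by rw [lt_div_iff₀ hC] at hlamC; linarith
  have hexp := integrable_exp (μ := μ) hf hM
  have hQ := measurable_QInf hα hlam hM
  have hQM : ∀ x, |QInf α lam f x| ≤ M := abs_QInf_le hα hlam.le hM
  set ν := μ.tilted f with hν
  have := isProbabilityMeasure_tilted hexp
  set Z := ∫ x, Real.exp (f x) ∂μ with hZ
  have hZ0 : 0 < Z := integral_exp_pos hexp
  have hfν := integrable_of_measurable_of_abs_le (μ := ν) hf hM
  have hQν := integrable_of_measurable_of_abs_le (μ := ν) hQ hQM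
  have htilt : ∀ φ : X → ℝ, ∫ x, φ x * Real.exp (f x) ∂μ = Z * ∫ x, φ x ∂ν := fun φ => by
    rw [hν, integral_tilted, ← integral_const_mul]
    refine integral_congr_ae (ae_of_all _ fun x => ?_)
    simp only [smul_eq_mul, ← hZ]
    field_simp
  set H := ∫ x, f x ∂ν - Real.log Z with hH
  have hllr : (fun x => Real.log (ν.rnDeriv μ x).toReal) =ᵐ[ν] fun x => f x - Real.log Z :=
    (tilted_absolutelyContinuous μ f).ae_le (log_rnDeriv_tilted_left_self hexp)
  have hrel : relEnt ν μ = ENNReal.ofReal H := by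
    rw [relEnt, if_pos ⟨tilted_absolutelyContinuous μ f,
      (integrable_congr hllr).2 (hfν.sub (integrable_const _))⟩, integral_congr_ae hllr,
      integral_sub hfν (integrable_const _)]
    simp [hH]
  have hent : entExp μ f = Z * H := by
    simp only [entExp, Real.log_exp]
    rw [← hZ, show (fun x => Real.exp (f x) * f x) = fun x => f x * Real.exp (f x) by
      ext; ring, htilt f, hH]
    ring
  have hjensen : ∫ x, f x ∂μ ≤ Real.log Z := by
    have := integral_sub_mul_exp_le (μ := μ) (f := fun _ => 0) measurable_const (M := 0)
      (by simp) hf hM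
    simpa using this
  have hH0 : 0 ≤ H := by
    have := integral_sub_mul_exp_le (μ := μ) hf hM (φ := fun _ => 0) measurable_const (N := 0)
      (by simp)
    rw [htilt fun x => 0 - f x, ← hZ, mul_le_mul_iff_right₀ hZ0] at this
    simp only [zero_sub, integral_neg, Real.exp_zero, integral_const, probReal_univ, one_smul,
      Real.log_one] at this
    linarith
  have key : H * (1 - lam * C) ≤ ∫ x, (f x - QInf α lam f x) ∂ν := by
    rw [integral_sub hfν hQν]
    refine le_of_forall_pos_le_add fun ε hε => ?_
    have ht : 0 ≤ C * H + ε / lam := by positivity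
    have hlt : transportCost α ν μ < ENNReal.ofReal (C * H + ε / lam) := by
      refine (h ν inferInstance).trans_lt ?_
      rw [hrel, ← ENNReal.ofReal_mul hC.le]
      refine (ENNReal.ofReal_lt_ofReal_iff (by positivity)).2 ?_
      linarith [div_pos hε hlam]
    obtain ⟨_, ⟨π, h₁, h₂, rfl⟩, hπ⟩ := sInf_lt_iff.1 hlt
    have := integral_sub_integral_le_of_coupling hα hlam hf hM h₁ h₂ ht hπ.le
    have h3 : lam * (C * H + ε / lam) = lam * C * H + ε := by field_simp
    linarith
  rw [hent, htilt fun x => f x - QInf α lam f x, one_div, ← div_eq_inv_mul, le_div_iff₀ hlC,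
    mul_assoc]
  exact mul_le_mul_of_nonneg_left key hZ0.le

end Equivalence

theorem transport_entropy_iff_tau_lsi
    {X : Type*} [MetricSpace X] [CompleteSpace X] [TopologicalSpace.SeparableSpace X]
    [ProperSpace X] [MeasurableSpace X] [BorelSpace X]
    (α : ℝ → ℝ) (hα : IsYoung α) (hΔ : DeltaTwo α)
    (μ : Measure X) [IsProbabilityMeasure μ] :
    ((∃ C > 0, TransportEntropy μ α C) ↔ ∃ lam > 0, ∃ A > 0, TauLSI μ α lam A) ∧
    (∀ C > 0, TransportEntropy μ α C →
      ∀ lam : ℝ, 0 < lam → lam < 1 / C → TauLSI μ α lam (1 / (1 - lam * C))) ∧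
    (∀ lam > 0, ∀ A > 0, TauLSI μ α lam A →
      TransportEntropy μ α ((1 / lam) *
        (pAlpha α ^ (pAlpha α * (pAlpha α - 1)) /
          (pAlpha α - 1) ^ ((pAlpha α - 1) * (pAlpha α - 1))) *
        max A 1 ^ (pAlpha α - 1))) := by
  refine ⟨⟨?_, ?_⟩, fun C hC h lam hlam hlamC => h.tauLSI hα hC hlam hlamC,
    fun lam hlam A _ h => h.transportEntropy hα hΔ hlam⟩
  · rintro ⟨C, hC, h⟩
    have hlt : 1 / (2 * C) < 1 / C := one_div_lt_one_div_of_lt hC (by linarith)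
    have hpos : 0 < 1 - 1 / (2 * C) * C := by
      rw [show 1 - 1 / (2 * C) * C = 1 / 2 by field_simp; norm_num]
      norm_num
    exact ⟨1 / (2 * C), by positivity, _, one_div_pos.2 hpos,
      h.tauLSI hα hC (by positivity) hlt⟩
  · rintro ⟨lam, hlam, A, _, h⟩
    exact ⟨_, transportConst_pos (hα.one_lt_pAlpha hΔ) hlam, h.transportEntropy hα hΔ hlam⟩
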